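/- arXiv:2509.18982 — 2 statements merged into one kernel-verified Lean document; each statement's English description precedes it below -/
import Mathlib

section
/- Fix integers m, n ≥ 1 and d ∈ ℕ. (1) Every left operator among {B^L_{±i} (i ∈ {1/2,…,m−1/2}), (d^L_0)^{±1}, (d^L_r)^{±1} (r ∈ {1,…,m})} commutes with every right operator among {B^R_{±i} (i ∈ {1/2,…,n−1/2}), (d^R_0)^{±1}, (d^R_r)^{±1} (r ∈ {1,…,n})} as ℚ(q)-linear endomorphisms of 𝒱^ȷ_{m|n,d}. (2) These two commuting actions satisfy the double centralizer property: the commutant in End(𝒱^ȷ_{m|n,d}) of the unital subalgebra generated by the left operators equals the unital subalgebra generated by the right operators, and vice versa. (This is the ıHowe duality between U^ȷ_m and U^ȷ_n on 𝒱^ȷ_{m|n,d}.) -/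
open scoped BigOperators Classical

set_option synthInstance.maxHeartbeats 1000000
set_option maxHeartbeats 1000000

noncomputable section

/-- The base field `ℚ(q)`. -/
abbrev K : Type := RatFunc ℚ

/-- The indeterminate `q`. -/
def q : K := RatFunc.X

/-- The quantum integer `[r] = (q^r - q^{-r})/(q - q^{-1})`. -/
def qint (r : ℤ) : K := (q ^ r - q ^ (-r)) / (q - q⁻¹)

/-- The quantum factorial `[r]!`. -/
def qfac : ℕ → K
  | 0 => 1
  | n+1 => qfac n * qint (n+1)

/-- The index set `𝕀_N = {-(N-1)/2, -(N-3)/2, …, (N-1)/2}` as a finite set of rationals. -/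
def II (N : ℕ) : Finset ℚ := (Finset.range N).image (fun k : ℕ => (k : ℚ) - ((N : ℚ) - 1) / 2)

theorem II_neg {N : ℕ} {a : ℚ} (h : a ∈ II N) : -a ∈ II N := by
  obtain ⟨k, hk, hv⟩ := Finset.mem_image.mp h
  rw [Finset.mem_range] at hk
  refine Finset.mem_image.mpr ⟨N - 1 - k, Finset.mem_range.mpr (by omega), ?_⟩
  have h1 : ((N - 1 - k : ℕ) : ℚ) = (N : ℚ) - 1 - (k : ℚ) := by
    have h2 : (N : ℚ) = ((N - 1 - k : ℕ) : ℚ) + (k : ℚ) + 1 := by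
      exact_mod_cast congrArg (Nat.cast : ℕ → ℚ) (by omega : N = (N - 1 - k) + k + 1)
    linarith
  rw [h1, ← hv]; ring

/-- Matrices with rational row/column labels and natural number entries. -/
abbrev Mat : Type := ℚ → ℚ → ℕ

/-- The θ-elementary matrix `E^θ_{r,c} = E_{r,c} + E_{-r,-c}`. -/
def chiM (r c : ℚ) : Mat := fun x y =>
  (if x = r ∧ y = c then 1 else 0) + (if x = -r ∧ y = -c then 1 else 0)

/-- `A + E^θ_{p,j} - E^θ_{p',j'}` (truncated ℕ-subtraction; only used where the
corresponding q-integer coefficient vanishes otherwise). -/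
def matMove (A : Mat) (p j p' j' : ℚ) : Mat := fun x y => A x y + chiM p j x y - chiM p' j' x y

/-- Free `ℚ(q)`-vector space on the set of matrices `P`. -/
abbrev FM (P : Set Mat) : Type := {A : Mat // A ∈ P} →₀ K

/-- Basis vector `t^{(A)}` (zero if `A ∉ P`). -/
def tP (P : Set Mat) (A : Mat) : FM P := if h : A ∈ P then Finsupp.single ⟨A, h⟩ 1 else 0

/-- Linear operator on `FM P` defined by its values on basis vectors. -/
def opOf {P : Set Mat} (f : Mat → FM P) : FM P →ₗ[K] FM P :=
  Finsupp.lift (FM P) K {A : Mat // A ∈ P} fun A => f A.1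

/-- The set `Ξ^j_{m|n,d}`: matrices supported on `{-m,…,m} × {-n,…,n}`, centro-symmetric,
with total entry sum `2d+1`.  (Note `𝕀_{2m+1} = {-m,…,m}`.) -/
def Xij (m n d : ℕ) : Set Mat :=
  {A | (∀ i j, A i j ≠ 0 → i ∈ II (2*m+1) ∧ j ∈ II (2*n+1)) ∧
       (∀ i j, A i j = A (-i) (-j)) ∧
       ∑ i ∈ II (2*m+1), ∑ j ∈ II (2*n+1), A i j = 2*d+1}

/-- Left operator `B^L_i` (j-case), for half-integers `i ∈ {1/2,…,m-1/2}`. -/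
def BLj (n : ℕ) (P : Set Mat) (i : ℚ) : FM P →ₗ[K] FM P :=
  opOf fun A =>
    (∑ j ∈ (II (2*n+1)).filter (fun j => j ≤ 0),
      if (if i = 1/2 ∧ j = 0 then 1 else 0) < A (i-1/2) j then
        (q ^ ((∑ k ∈ (II (2*n+1)).filter (fun k => j ≤ k), ((A (i+1/2) k : ℤ) - (A (i-1/2) k : ℤ)))
              + 1 + (if i = 1/2 then 1 else 0))
          * qint ((A (i-1/2) j : ℤ) - (if i = 1/2 ∧ j = 0 then 1 else 0)))
          • tP P (matMove A (i+1/2) j (i-1/2) j)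
      else 0)
    + (∑ j ∈ (II (2*n+1)).filter (fun j => 0 < j),
        (q ^ ((∑ k ∈ (II (2*n+1)).filter (fun k => j ≤ k), ((A (i+1/2) k : ℤ) - (A (i-1/2) k : ℤ))) + 1)
          * qint (A (i-1/2) j)) • tP P (matMove A (i+1/2) j (i-1/2) j))

/-- Left operator `B^L_{-i}` (j-case), for half-integers `i ∈ {1/2,…,m-1/2}`. -/
def BLjn (n : ℕ) (P : Set Mat) (i : ℚ) : FM P →ₗ[K] FM P :=
  opOf fun A => ∑ j ∈ II (2*n+1),
    (q ^ ((∑ k ∈ (II (2*n+1)).filter (fun k => k ≤ j), ((A (i-1/2) k : ℤ) - (A (i+1/2) k : ℤ))) + 1)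
      * qint (A (i+1/2) j)) • tP P (matMove A (i-1/2) j (i+1/2) j)

/-- Left Cartan operator `(d^L_0)^e`, `e = ±1` (j-case). -/
def dL0j (n : ℕ) (P : Set Mat) (e : ℤ) : FM P →ₗ[K] FM P :=
  opOf fun A => (q ^ (e * (((∑ j ∈ II (2*n+1), (A 0 j : ℤ)) - 1) / 2))) • tP P A

/-- Left Cartan operator `(d^L_r)^e`, `r ∈ {1,…,m}`, `e = ±1` (j-case). -/
def dLj (n : ℕ) (P : Set Mat) (r : ℚ) (e : ℤ) : FM P →ₗ[K] FM P :=
  opOf fun A => (q ^ (e * ∑ j ∈ II (2*n+1), (A r j : ℤ))) • tP P A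

/-- Right operator `B^R_i` (j-case), for half-integers `i ∈ {1/2,…,n-1/2}`. -/
def BRj (m : ℕ) (P : Set Mat) (i : ℚ) : FM P →ₗ[K] FM P :=
  opOf fun A => ∑ j ∈ II (2*m+1),
    (q ^ (∑ k ∈ (II (2*m+1)).filter (fun k => j < k), ((A k (i+1/2) : ℤ) - (A k (i-1/2) : ℤ)))
      * qint (A j (i+1/2))) • tP P (matMove A j (i-1/2) j (i+1/2))

/-- Right operator `B^R_{-i}` (j-case), for half-integers `i ∈ {1/2,…,n-1/2}`. -/
def BRjn (m : ℕ) (P : Set Mat) (i : ℚ) : FM P →ₗ[K] FM P :=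
  opOf fun A =>
    (∑ j ∈ (II (2*m+1)).filter (fun j => j ≤ 0),
      if (if i = 1/2 ∧ j = 0 then 1 else 0) < A j (i-1/2) then
        (q ^ (∑ k ∈ (II (2*m+1)).filter (fun k => k < j), ((A k (i-1/2) : ℤ) - (A k (i+1/2) : ℤ)))
          * qint ((A j (i-1/2) : ℤ) - (if i = 1/2 ∧ j = 0 then 1 else 0)))
          • tP P (matMove A j (i+1/2) j (i-1/2))
      else 0)
    + (∑ j ∈ (II (2*m+1)).filter (fun j => 0 < j),
        (q ^ ((∑ k ∈ (II (2*m+1)).filter (fun k => k < j), ((A k (i-1/2) : ℤ) - (A k (i+1/2) : ℤ)))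
              - (if i = 1/2 then 1 else 0))
          * qint (A j (i-1/2))) • tP P (matMove A j (i+1/2) j (i-1/2)))

/-- Right Cartan operator `(d^R_r)^e`, `r ∈ {1,…,n}`, `e = ±1` (j-case). -/
def dRj (m : ℕ) (P : Set Mat) (r : ℚ) (e : ℤ) : FM P →ₗ[K] FM P :=
  opOf fun A => (q ^ (e * ∑ k ∈ II (2*m+1), (A k r : ℤ))) • tP P A

/-- Right Cartan operator `(d^R_0)^e`, `e = ±1` (j-case). -/
def dR0j (m : ℕ) (P : Set Mat) (e : ℤ) : FM P →ₗ[K] FM P :=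
  opOf fun A => (q ^ (e * (((∑ k ∈ II (2*m+1), (A k 0 : ℤ)) - 1) / 2))) • tP P A

/-- The generating set of left operators on `𝒱^ȷ_{m|n,d}`:
`B^L_{±i}` (`i ∈ {1/2,…,m-1/2}`), `(d^L_0)^{±1}`, and `(d^L_r)^{±1}` (`r ∈ {1,…,m}`). -/
def gensLj (m n d : ℕ) : Set (Module.End K (FM (Xij m n d))) :=
  {O | (∃ i ∈ II (2*m), 0 < i ∧ (O = BLj n (Xij m n d) i ∨ O = BLjn n (Xij m n d) i))
     ∨ O = dL0j n (Xij m n d) 1 ∨ O = dL0j n (Xij m n d) (-1)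
     ∨ (∃ r ∈ II (2*m+1), 0 < r ∧ (O = dLj n (Xij m n d) r 1 ∨ O = dLj n (Xij m n d) r (-1)))}

/-- The generating set of right operators on `𝒱^ȷ_{m|n,d}`:
`B^R_{±i}` (`i ∈ {1/2,…,n-1/2}`), `(d^R_0)^{±1}`, and `(d^R_r)^{±1}` (`r ∈ {1,…,n}`). -/
def gensRj (m n d : ℕ) : Set (Module.End K (FM (Xij m n d))) :=
  {O | (∃ i ∈ II (2*n), 0 < i ∧ (O = BRj m (Xij m n d) i ∨ O = BRjn m (Xij m n d) i))
     ∨ O = dR0j m (Xij m n d) 1 ∨ O = dR0j m (Xij m n d) (-1)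
     ∨ (∃ r ∈ II (2*n+1), 0 < r ∧ (O = dRj m (Xij m n d) r 1 ∨ O = dRj m (Xij m n d) r (-1)))}

/-- A ring homomorphism from `ℚ(q)` to the real numbers sending `q` to a positive number `≠ 1`. -/
theorem exists_realEval : ∃ φ : K →+* ℝ, 0 < φ q ∧ φ q ≠ 1 := by
  have ht : Transcendental ℚ (liouvilleNumber 2) := fun h =>
    transcendental_liouvilleNumber (m := 2) le_rfl
      (by exact_mod_cast (IsFractionRing.isAlgebraic_iff ℤ ℚ ℝ).2 h)
  have hinj := transcendental_iff_injective.1 ht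
  have hle := nonZeroDivisors_le_comap_nonZeroDivisors_of_injective
    (Polynomial.aeval (R := ℚ) (liouvilleNumber 2)).toRingHom hinj
  refine ⟨RatFunc.liftRingHom _ hle, ?_⟩
  have hq : RatFunc.liftRingHom _ hle q = liouvilleNumber 2 := by
    have := RatFunc.liftRingHom_apply_div _ hle Polynomial.X 1
    simp [q]
  have hsum : Summable fun i : ℕ => 1 / (2 : ℝ) ^ i.factorial := LiouvilleNumber.summable (by norm_num)
  rw [hq]
  refine ⟨hsum.tsum_pos (fun i => by positivity) 0 (by positivity), fun h => ?_⟩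
  rw [h] at ht
  exact ht isAlgebraic_one

theorem q_zpow_injective : Function.Injective (fun k : ℤ => q ^ k) := by
  obtain ⟨φ, h0, h1⟩ := exists_realEval
  intro a b h
  have h2 : φ q ^ a = φ q ^ b := by simpa using congrArg φ h
  exact zpow_right_injective₀ h0 h1 h2

theorem q_ne_zero : q ≠ 0 := RatFunc.X_ne_zero

theorem q_sub_inv_ne_zero : q - q⁻¹ ≠ 0 := by
  intro h
  have h1 : q ^ (1 : ℤ) = q ^ (-1 : ℤ) := by
    simpa [sub_eq_zero] using h
  have := q_zpow_injective h1
  omega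

theorem qint_zero : qint 0 = 0 := by simp [qint]

theorem qint_ne_zero {k : ℤ} (hk : k ≠ 0) : qint k ≠ 0 := by
  refine div_ne_zero (fun h => hk ?_) q_sub_inv_ne_zero
  have := q_zpow_injective (sub_eq_zero.1 h)
  omega

theorem qint_succ (k : ℤ) : qint (k + 1) = q * qint k + q ^ (-k) := by
  have h0 := q_ne_zero
  have h1 := q_sub_inv_ne_zero
  rw [qint, qint, mul_div_assoc', div_add' _ _ _ h1]
  congr 1
  rw [neg_add, zpow_add₀ h0, zpow_add₀ h0]
  simp only [zpow_one, zpow_neg]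
  ring

theorem qint_succ' (k : ℤ) : qint (k + 1) = q⁻¹ * qint k + q ^ k := by
  have h0 := q_ne_zero
  have h1 := q_sub_inv_ne_zero
  rw [qint, qint, mul_div_assoc', div_add' _ _ _ h1]
  congr 1
  rw [neg_add, zpow_add₀ h0, zpow_add₀ h0]
  simp only [zpow_one, zpow_neg]
  ring

theorem realEval_qint_pos {φ : K →+* ℝ} (h : 0 < φ q) (k : ℕ) : 0 < φ (qint (k + 1)) := by
  induction k with
  | zero =>
    have := qint_succ 0
    simp [qint_zero] at this
    simp [this]
  | succ k ih =>
    rw [qint_succ, map_add, map_mul, map_zpow₀]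
    push_cast
    have := zpow_pos h (-((k : ℤ) + 1))
    positivity

theorem q_zpow_ne_zero (k : ℤ) : q ^ k ≠ 0 := zpow_ne_zero _ q_ne_zero

/-- Integer matrices with rows and columns labelled by `ℤ`. -/
abbrev ZMat : Type := ℤ → ℤ → ℤ

/-- Transposition of integer matrices. -/
def trZ (A : ZMat) : ZMat := fun i j => A j i

/-- The integer version of `E^θ_{r,c}`. -/
def eTh (r c : ℤ) : ZMat := fun x y =>
  (if x = r ∧ y = c then 1 else 0) + (if x = -r ∧ y = -c then 1 else 0)

/-- The increment moving one unit (and its mirror image) from row `p` to row `p + 1` in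
column `j`. -/
def rowMove (p j : ℤ) : ZMat := eTh (p + 1) j - eTh p j

/-- The integer model of `Ξ^ȷ_{m|n,d}`. -/
def XiZ (m n d : ℕ) : Set ZMat :=
  {A | (∀ i j, 0 ≤ A i j) ∧
       (∀ i j, A i j ≠ 0 → (-(m : ℤ) ≤ i ∧ i ≤ m) ∧ (-(n : ℤ) ≤ j ∧ j ≤ n)) ∧
       (∀ i j, A (-i) (-j) = A i j) ∧
       ∑ i ∈ Finset.Icc (-(m : ℤ)) m, ∑ j ∈ Finset.Icc (-(n : ℤ)) n, A i j = 2 * d + 1}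

/-- The exponent of `q` in the coefficient of a normalized row move. -/
def expo (n : ℕ) (p j : ℤ) (A : ZMat) : ℤ :=
  ∑ k ∈ Finset.Ico (-(n : ℤ)) j, (A p k - A (p + 1) k) - if p = 0 ∧ 0 < j then 1 else 0

/-- The argument of the quantum integer in the coefficient of a row move. -/
def cnt (p j : ℤ) (A : ZMat) : ℤ := A p j - if p = 0 ∧ j = 0 then 1 else 0

/-- The coefficient of a normalized row move. -/
def coef (n : ℕ) (p j : ℤ) (A : ZMat) : K := q ^ expo n p j A * qint (cnt p j A)

theorem trZ_trZ (A : ZMat) : trZ (trZ A) = A := rfl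

theorem trZ_add (A B : ZMat) : trZ (A + B) = trZ A + trZ B := rfl

theorem trZ_eTh (r c : ℤ) : trZ (eTh r c) = eTh c r := by
  funext x y
  simp only [trZ, eTh, and_comm]

theorem trZ_rowMove (r i : ℤ) : trZ (rowMove r i) = eTh i (r + 1) - eTh i r := by
  rw [← trZ_eTh (r + 1) i, ← trZ_eTh r i]; rfl

theorem sum_Ico_ite (n : ℕ) (p x y j : ℤ) (hy : -(n : ℤ) ≤ y) :
    ∑ k ∈ Finset.Ico (-(n : ℤ)) j, (if p = x ∧ k = y then (1 : ℤ) else 0)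
      = if p = x ∧ y < j then 1 else 0 := by
  by_cases hP : p = x
  · simp only [hP, true_and, Finset.sum_ite_eq', Finset.mem_Ico, hy]
  · simp [hP]

theorem sum_Ico_eTh (n : ℕ) (x y p j : ℤ) (hy : -(n : ℤ) ≤ y) (hy' : y ≤ n) :
    ∑ k ∈ Finset.Ico (-(n : ℤ)) j, eTh x y p k
      = (if p = x ∧ y < j then 1 else 0) + if p = -x ∧ -y < j then 1 else 0 := by
  simp only [eTh, Finset.sum_add_distrib]
  rw [sum_Ico_ite _ _ _ _ _ hy, sum_Ico_ite _ _ _ _ _ (by omega)]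

theorem expo_add (n : ℕ) (p j : ℤ) (A B : ZMat) : expo n p j (A + B)
    = expo n p j A + ∑ k ∈ Finset.Ico (-(n : ℤ)) j, (B p k - B (p + 1) k) := by
  simp only [expo, Pi.add_apply, Finset.sum_sub_distrib, Finset.sum_add_distrib]
  ring

theorem expo_succ (n : ℕ) (p j : ℤ) (A : ZMat) (hj : -(n : ℤ) ≤ j) : expo n p (j + 1) A
    = expo n p j A + A p j - A (p + 1) j - if p = 0 ∧ j = 0 then 1 else 0 := by
  rw [expo, expo, ← Finset.insert_Ico_right_eq_Ico_add_one hj, Finset.sum_insert (by simp)]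
  have : (if p = 0 ∧ 0 < j + 1 then (1 : ℤ) else 0)
      = (if p = 0 ∧ 0 < j then 1 else 0) + if p = 0 ∧ j = 0 then 1 else 0 := by
    split_ifs <;> omega
  rw [this]; ring

theorem expo_add_colMove (n : ℕ) (p j r i : ℤ) (A : ZMat) (hr : -(n : ℤ) ≤ r) (hr' : r < n) :
    expo n p j (A + trZ (rowMove r i)) = expo n p j A
      - (if p = i ∧ j = r + 1 then 1 else 0) + (if p + 1 = i ∧ j = r + 1 then 1 else 0)
      + (if p = -i ∧ j = -r then 1 else 0) - (if p + 1 = -i ∧ j = -r then 1 else 0) := by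
  rw [expo_add, trZ_rowMove]
  simp only [Pi.sub_apply, Finset.sum_sub_distrib]
  rw [sum_Ico_eTh _ _ _ _ _ (by omega) (by omega), sum_Ico_eTh _ _ _ _ _ (by omega) (by omega),
    sum_Ico_eTh _ _ _ _ _ (by omega) (by omega), sum_Ico_eTh _ _ _ _ _ (by omega) (by omega)]
  have h1 (x y : ℤ) : (if x = y ∧ r < j then (1 : ℤ) else 0) - (if x = y ∧ r + 1 < j then 1 else 0)
      = if x = y ∧ j = r + 1 then 1 else 0 := by omega
  have h2 (x y : ℤ) : (if x = y ∧ -(r + 1) < j then (1 : ℤ) else 0)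
      - (if x = y ∧ -r < j then 1 else 0) = if x = y ∧ j = -r then 1 else 0 := by omega
  rw [← h1, ← h1, ← h2, ← h2]; ring

theorem cnt_add_colMove (p j r i : ℤ) (A : ZMat) :
    cnt p j (A + trZ (rowMove r i)) = cnt p j A
      + (if p = i ∧ j = r + 1 then 1 else 0) - (if p = i ∧ j = r then 1 else 0)
      + (if p = -i ∧ j = -r - 1 then 1 else 0) - (if p = -i ∧ j = -r then 1 else 0) := by
  rw [trZ_rowMove]
  simp only [cnt, Pi.sub_apply, Pi.add_apply, eTh, neg_add']
  ring

theorem gap_right (x y a c e : ℤ) (he : e = x + y - a - 1) :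
    q ^ y * qint c * (q ^ (x - 1) * qint (a + 1)) - q ^ x * qint a * (q ^ y * qint c)
      = q ^ e * qint c := by
  have h0 := q_ne_zero
  have : q ^ e = q ^ x * q ^ y * q ^ (-a) * q⁻¹ := by
    rw [he, sub_eq_add_neg, sub_eq_add_neg, zpow_add₀ h0, zpow_add₀ h0, zpow_add₀ h0]; simp
  rw [this, qint_succ, zpow_sub_one₀ h0]
  field_simp; ring

theorem gap_left (x y a c e : ℤ) (he : e = x + y + a) :
    q ^ y * qint c * (q ^ x * qint (a + 1)) - q ^ x * qint a * (q ^ (y - 1) * qint c)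
      = q ^ e * qint c := by
  have h0 := q_ne_zero
  have : q ^ e = q ^ x * q ^ y * q ^ a := by
    rw [he, zpow_add₀ h0, zpow_add₀ h0]
  rw [this, qint_succ', zpow_sub_one₀ h0]
  field_simp; ring

theorem gap_both (x y a c e f : ℤ) (he : e = x + y - a - 2) (hf : f = x + y + a) :
    q ^ y * qint c * (q ^ (x - 1) * qint (a + 2)) - q ^ x * qint a * (q ^ (y - 1) * qint c)
      = q ^ e * qint c + q ^ f * qint c := by
  have h0 := q_ne_zero
  have h1 : q ^ e = q ^ x * q ^ y * q ^ (-a) * q⁻¹ * q⁻¹ := by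
    rw [he, show x + y - a - 2 = x + y + (-a) - 1 - 1 by ring, zpow_sub_one₀ h0, zpow_sub_one₀ h0,
      zpow_add₀ h0, zpow_add₀ h0]
  have h2 : q ^ f = q ^ x * q ^ y * q ^ a := by
    rw [hf, zpow_add₀ h0, zpow_add₀ h0]
  rw [h1, h2, show a + 2 = a + 1 + 1 by ring, qint_succ, qint_succ', zpow_sub_one₀ h0,
    zpow_sub_one₀ h0, neg_add, zpow_add₀ h0 (-a) (-1), zpow_neg_one]
  field_simp; ring

/-- The difference of the coefficients of a row move and a column move applied in the two possible
orders. -/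
def gap (m n : ℕ) (p r i j : ℤ) (A : ZMat) : K :=
  coef m r i (trZ A) * coef n p j (A + trZ (rowMove r i))
    - coef n p j A * coef m r i (trZ A + trZ (rowMove p j))

/-- The common value of the gap at the two cells `(p, r + 1)` and `(p + 1, r)`. -/
def gapU (m n : ℕ) (p r : ℤ) (A : ZMat) : K :=
  q ^ (expo n p (r + 1) A + expo m r p (trZ A) - A p (r + 1) - 1) * qint (cnt r p (trZ A))

/-- The common value of the gap at the two cells `(-p, -r - 1)` and `(-p - 1, -r)`. -/
def gapW (m n : ℕ) (p r : ℤ) (A : ZMat) : K :=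
  q ^ (expo n p (-r - 1) A + expo m r (-p) (trZ A) + A p (-r - 1) - if p = 0 ∧ r = -1 then 1 else 0)
    * qint (cnt r (-p) (trZ A))

theorem gap_generic (x y a c dx dy da dc : ℤ) (h : dx = dy) (h' : da = dc) (h'' : da = 0 ∨ a = c) :
    q ^ y * qint c * (q ^ (x + dx) * qint (a + da))
      - q ^ x * qint a * (q ^ (y + dy) * qint (c + dc)) = 0 := by
  subst h h'
  rw [zpow_add₀ q_ne_zero, zpow_add₀ q_ne_zero]
  rcases h'' with rfl | rfl
  · simp only [add_zero]; ring
  · ring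

theorem gap_expand {m n : ℕ} {p r i j : ℤ} {A : ZMat} (hp : -(m : ℤ) ≤ p) (hp' : p < m)
    (hr : -(n : ℤ) ≤ r) (hr' : r < n) (dx dy da dc : ℤ)
    (hdx : - (if p = i ∧ j = r + 1 then 1 else 0) + (if p + 1 = i ∧ j = r + 1 then 1 else 0)
      + (if p = -i ∧ j = -r then 1 else 0) - (if p + 1 = -i ∧ j = -r then 1 else 0) = dx)
    (hdy : - (if r = j ∧ i = p + 1 then 1 else 0) + (if r + 1 = j ∧ i = p + 1 then 1 else 0)
      + (if r = -j ∧ i = -p then 1 else 0) - (if r + 1 = -j ∧ i = -p then 1 else 0) = dy)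
    (hda : (if p = i ∧ j = r + 1 then 1 else 0) - (if p = i ∧ j = r then 1 else 0)
      + (if p = -i ∧ j = -r - 1 then 1 else 0) - (if p = -i ∧ j = -r then 1 else 0) = da)
    (hdc : (if r = j ∧ i = p + 1 then 1 else 0) - (if r = j ∧ i = p then 1 else 0)
      + (if r = -j ∧ i = -p - 1 then 1 else 0) - (if r = -j ∧ i = -p then 1 else 0) = dc) :
    gap m n p r i j A = q ^ expo m r i (trZ A) * qint (cnt r i (trZ A))
        * (q ^ (expo n p j A + dx) * qint (cnt p j A + da))
      - q ^ expo n p j A * qint (cnt p j A)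
        * (q ^ (expo m r i (trZ A) + dy) * qint (cnt r i (trZ A) + dc)) := by
  rw [gap, coef, coef, coef, coef, expo_add_colMove n p j r i A hr hr',
    expo_add_colMove m r i p j (trZ A) hp hp', cnt_add_colMove, cnt_add_colMove]
  rw [← hdx, ← hdy, ← hda, ← hdc]
  simp only [add_assoc, sub_eq_add_neg]

theorem gap_eq_zero {m n : ℕ} {p r i j : ℤ} {A : ZMat} (hp : -(m : ℤ) ≤ p) (hp' : p < m)
    (hr : -(n : ℤ) ≤ r) (hr' : r < n) (hA : ∀ i j, A (-i) (-j) = A i j)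
    (h1 : ¬(i = p ∧ j = r + 1)) (h2 : ¬(i = p + 1 ∧ j = r)) (h3 : ¬(i = -p ∧ j = -r - 1))
    (h4 : ¬(i = -p - 1 ∧ j = -r)) : gap m n p r i j A = 0 := by
  rw [gap_expand hp hp' hr hr' _ _ _ _ rfl rfl rfl rfl]
  refine gap_generic _ _ _ _ _ _ _ _ ?_ ?_ ?_
  · split_ifs <;> omega
  · split_ifs <;> omega
  · by_cases h5 : i = p ∧ j = r
    · obtain ⟨rfl, rfl⟩ := h5
      right; simp only [cnt, trZ]; omega
    by_cases h6 : i = -p ∧ j = -r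
    · obtain ⟨rfl, rfl⟩ := h6
      right
      have := hA p (-r); rw [neg_neg] at this
      simp only [cnt, trZ]; omega
    · left; split_ifs <;> omega

theorem gap_eq {m n : ℕ} {p r i j : ℤ} {A : ZMat} (hp : -(m : ℤ) ≤ p) (hp' : p < m)
    (hr : -(n : ℤ) ≤ r) (hr' : r < n) (hA : ∀ i j, A (-i) (-j) = A i j) :
    gap m n p r i j A = (if i = p ∧ j = r + 1 then gapU m n p r A else 0)
      - (if i = p + 1 ∧ j = r then gapU m n p r A else 0)
      + (if i = -p ∧ j = -r - 1 then gapW m n p r A else 0)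
      - (if i = -p - 1 ∧ j = -r then gapW m n p r A else 0) := by
  have ex1 := expo_succ n p r A hr
  have ey1 := expo_succ m r p (trZ A) hp
  have ex2 := expo_succ n p (-r - 1) A (by omega)
  have ey2 := expo_succ m r (-p - 1) (trZ A) (by omega)
  rw [sub_add_cancel] at ex2 ey2
  have s1 := hA p r
  have s2 := hA (p + 1) r
  have s3 := hA p (r + 1)
  have s4 := hA (p + 1) (-r - 1)
  rw [neg_add'] at s2 s3 s4
  rw [show -(-r - 1) = r + 1 by ring] at s4
  simp only [trZ] at ey1 ey2
  by_cases h1 : i = p ∧ j = r + 1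
  · obtain ⟨rfl, rfl⟩ := h1
    by_cases h5 : i = 0 ∧ r = -1
    · obtain ⟨rfl, rfl⟩ := h5
      rw [gap_expand hp hp' hr hr' (-1) (-1) 2 0 (by simp) (by simp) (by simp) (by simp), add_zero]
      rw [if_pos (by omega), if_neg (by omega), if_pos (by omega), if_neg (by omega), sub_zero,
        sub_zero, gapU, gapW]
      refine gap_both _ _ _ _ _ _ ?_ ?_
      · simp [cnt]; ring
      · simp [cnt]; ring
    · rw [gap_expand hp hp' hr hr' (-1) 0 1 0 (by omega) (by omega)
        (by omega) (by omega), add_zero, add_zero, if_pos (by omega),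
        if_neg (by omega), if_neg (by omega), if_neg (by omega), sub_zero, add_zero, sub_zero, gapU,
        ← sub_eq_add_neg]
      refine gap_right _ _ _ _ _ ?_
      simp only [cnt]
      omega
  by_cases h2 : i = p + 1 ∧ j = r
  · obtain ⟨rfl, rfl⟩ := h2
    by_cases h5 : p = -1 ∧ j = 0
    · obtain ⟨rfl, rfl⟩ := h5
      rw [gap_expand hp hp' hr hr' (-1) (-1) 0 2 (by simp) (by simp) (by simp) (by simp), add_zero,
        if_neg (by omega), if_pos (by omega), if_neg (by omega), if_pos (by omega), zero_sub,
        add_zero, gapU, gapW]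
      have h1 : cnt 0 (-1) (trZ A) = cnt (-1) 0 A := by simp [cnt, trZ]
      have h2 : cnt 0 (-(-1)) (trZ A) = cnt (-1) 0 A := by simpa [cnt, trZ] using s1
      rw [h1, h2, ← sub_eq_add_neg, ← neg_sub, ← neg_add', neg_inj]
      refine gap_both _ _ _ _ _ _ ?_ ?_
      · simp [cnt, trZ] at *; omega
      · simp [cnt, trZ] at *; omega
    · rw [gap_expand hp hp' hr hr' 0 (-1) 0 1 (by omega) (by omega)
        (by omega) (by omega), add_zero, add_zero, if_neg (by omega),
        if_pos (by omega), if_neg (by omega), if_neg (by omega), zero_sub, add_zero, sub_zero, gapU,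
        ← sub_eq_add_neg, ← neg_sub, neg_inj]
      have : cnt p j A = cnt j p (trZ A) := by simp only [cnt, trZ]; omega
      rw [← this]
      refine gap_right _ _ _ _ _ ?_
      simp only [cnt, trZ]
      omega
  by_cases h3 : i = -p ∧ j = -r - 1
  · obtain ⟨rfl, rfl⟩ := h3
    rw [gap_expand hp hp' hr hr' 0 (-1) 1 0 (by omega) (by omega)
        (by omega) (by omega), add_zero, add_zero, if_neg (by omega),
        if_neg (by omega), if_pos (by omega), if_neg (by omega), zero_sub, sub_zero, gapW,
        ← sub_eq_add_neg, neg_zero, zero_add]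
    refine gap_left _ _ _ _ _ ?_
    simp only [cnt]
    omega
  by_cases h4 : i = -p - 1 ∧ j = -r
  · obtain ⟨rfl, rfl⟩ := h4
    rw [gap_expand hp hp' hr hr' (-1) 0 0 1 (by omega) (by omega)
        (by omega) (by omega), add_zero, add_zero, if_neg (by omega),
        if_neg (by omega), if_neg (by omega), if_pos (by omega), zero_sub, neg_zero, zero_add,
        zero_sub, gapW, ← sub_eq_add_neg, ← neg_sub, neg_inj]
    have : cnt p (-r) A = cnt r (-p) (trZ A) := by
      have := hA p (-r); rw [neg_neg] at this
      simp only [cnt, trZ]; omega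
    rw [← this]
    refine gap_left _ _ _ _ _ ?_
    simp only [cnt, trZ]
    omega
  · rw [gap_eq_zero hp hp' hr hr' hA h1 h2 h3 h4, if_neg h1, if_neg h2, if_neg h3, if_neg h4]
    simp only [sub_zero, add_zero]

theorem exists_sum_Icc_neg_eq (n : ℕ) (f : ℤ → ℤ) (hf : ∀ j, f (-j) = f j) :
    ∃ c, ∑ j ∈ Finset.Icc (-(n : ℤ)) n, f j = f 0 + 2 * c := by
  induction n with
  | zero => exact ⟨0, by simp⟩
  | succ n ih =>
    obtain ⟨c, hc⟩ := ih
    refine ⟨c + f (n + 1), ?_⟩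
    have : Finset.Icc (-((n + 1 : ℕ) : ℤ)) ((n + 1 : ℕ) : ℤ)
        = insert (-((n : ℤ) + 1)) (insert ((n : ℤ) + 1) (Finset.Icc (-(n : ℤ)) n)) := by
      ext x; simp only [Finset.mem_Icc, Finset.mem_insert]; push_cast; omega
    rw [this, Finset.sum_insert, Finset.sum_insert, hc, hf]
    · ring
    · simp
    · simp only [Finset.mem_Icc, Finset.mem_insert]; omega

theorem sum_Icc_comp_neg {M : Type*} [AddCommMonoid M] (n : ℕ) (f : ℤ → M) :
    ∑ j ∈ Finset.Icc (-(n : ℤ)) n, f (-j) = ∑ j ∈ Finset.Icc (-(n : ℤ)) n, f j := by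
  refine Finset.sum_nbij' (fun j => -j) (fun j => -j) ?_ ?_ ?_ ?_ ?_ <;>
    simp only [Finset.mem_Icc, neg_neg, implies_true]
  all_goals intro j hj; omega

/-- The sum of the entries in a row. -/
def rowSum (n : ℕ) (r : ℤ) (A : ZMat) : ℤ := ∑ k ∈ Finset.Icc (-(n : ℤ)) n, A r k

theorem trZ_mem_XiZ {m n d : ℕ} {A : ZMat} (hA : A ∈ XiZ m n d) : trZ A ∈ XiZ n m d := by
  obtain ⟨h1, h2, h3, h4⟩ := hA
  refine ⟨fun i j => h1 j i, fun i j h => (h2 j i h).symm, fun i j => h3 j i, ?_⟩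
  rw [Finset.sum_comm]; exact h4

theorem rowSum_neg {m n d : ℕ} {A : ZMat} (hA : A ∈ XiZ m n d) (r : ℤ) :
    rowSum n (-r) A = rowSum n r A := by
  rw [rowSum, ← sum_Icc_comp_neg]
  exact Finset.sum_congr rfl fun j _ => hA.2.2.1 r j

theorem rowSum_zero_odd {m n d : ℕ} {A : ZMat} (hA : A ∈ XiZ m n d) :
    ∃ c, rowSum n 0 A = 2 * c + 1 := by
  obtain ⟨c, hc⟩ := exists_sum_Icc_neg_eq m (fun i => rowSum n i A) (rowSum_neg hA)
  have := hA.2.2.2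
  simp only [rowSum] at *
  exact ⟨d - c, by linarith⟩

theorem entry_zero_odd {m n d : ℕ} {A : ZMat} (hA : A ∈ XiZ m n d) : ∃ c, A 0 0 = 2 * c + 1 := by
  obtain ⟨c, hc⟩ := rowSum_zero_odd hA
  obtain ⟨c', hc'⟩ := exists_sum_Icc_neg_eq n (A 0) (fun j => by simpa using hA.2.2.1 0 j)
  simp only [rowSum] at *
  exact ⟨c - c', by linarith⟩

theorem sum_Icc_eTh (n : ℕ) (x y s : ℤ) (hy : -(n : ℤ) ≤ y) (hy' : y ≤ n) :
    ∑ k ∈ Finset.Icc (-(n : ℤ)) n, eTh x y s k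
      = (if s = x then 1 else 0) + if s = -x then 1 else 0 := by
  have := sum_Ico_eTh n x y s (n + 1) hy hy'
  rw [show Finset.Icc (-(n : ℤ)) n = Finset.Ico (-(n : ℤ)) (n + 1) by ext; simp, this,
    if_congr (and_iff_left (by omega)) rfl rfl, if_congr (and_iff_left (by omega)) rfl rfl]

theorem rowSum_add_eTh_sub (n : ℕ) (x y z w s : ℤ) (A : ZMat) (hy : -(n : ℤ) ≤ y) (hy' : y ≤ n)
    (hw : -(n : ℤ) ≤ w) (hw' : w ≤ n) : rowSum n s (A + (eTh x y - eTh z w))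
      = rowSum n s A + ((if s = x then 1 else 0) + if s = -x then 1 else 0)
        - ((if s = z then 1 else 0) + if s = -z then 1 else 0) := by
  simp only [rowSum, Pi.add_apply, Pi.sub_apply, Finset.sum_add_distrib, Finset.sum_sub_distrib]
  rw [sum_Icc_eTh _ _ _ _ hy hy', sum_Icc_eTh _ _ _ _ hw hw']
  ring

theorem rowSum_add_colMove (n : ℕ) (r i s : ℤ) (A : ZMat) (hr : -(n : ℤ) ≤ r) (hr' : r < n) :
    rowSum n s (A + trZ (rowMove r i)) = rowSum n s A := by
  rw [trZ_rowMove, rowSum_add_eTh_sub n _ _ _ _ _ _ (by omega) (by omega) hr (by omega)]; ring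

theorem add_rowMove_mem {m n d : ℕ} {A : ZMat} (hA : A ∈ XiZ m n d) {p j : ℤ} (hp : -(m : ℤ) ≤ p)
    (hp' : p < m) (hj : -(n : ℤ) ≤ j) (hj' : j ≤ n) (hc : cnt p j A ≠ 0) :
    A + rowMove p j ∈ XiZ m n d := by
  obtain ⟨h1, h2, h3, h4⟩ := id hA
  obtain ⟨c, hodd⟩ := entry_zero_odd hA
  refine ⟨fun x y => ?_, fun x y => ?_, fun x y => ?_, ?_⟩
  · have hnn := h1 x y
    have hpj := h1 p j
    simp only [Pi.add_apply, rowMove, Pi.sub_apply, eTh]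
    simp only [cnt] at hc
    by_cases e1 : x = p ∧ y = j
    · obtain ⟨rfl, rfl⟩ := e1
      by_cases e2 : x = 0 ∧ y = 0
      · obtain ⟨rfl, rfl⟩ := e2
        simp at hc ⊢
        omega
      · rw [if_neg e2] at hc
        split_ifs <;> omega
    · by_cases e2 : x = -p ∧ y = -j
      · obtain ⟨rfl, rfl⟩ := e2
        have := h3 p j
        rw [if_neg (by omega)] at hc
        split_ifs <;> omega
      · split_ifs <;> omega
  · simp only [Pi.add_apply, rowMove, Pi.sub_apply, eTh]
    intro h
    by_cases h0 : A x y = 0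
    · split_ifs at h <;> omega
    · exact h2 x y h0
  · have := h3 x y
    simp only [Pi.add_apply, rowMove, Pi.sub_apply, eTh, this, neg_eq_iff_eq_neg]
    ring_nf
  · have (s : ℤ) : ∑ k ∈ Finset.Icc (-(n : ℤ)) n, (A + rowMove p j) s k = _ :=
      rowSum_add_eTh_sub n (p + 1) j p j s A hj hj' hj hj'
    simp only [rowSum] at this
    simp only [this, Finset.sum_add_distrib, Finset.sum_sub_distrib, h4, Finset.sum_ite_eq',
      Finset.mem_Icc]
    split_ifs <;> omega

section Operators

variable {V : Type*} [AddCommGroup V] [Module K V] {m n d : ℕ} (b : Module.Basis (XiZ m n d) K V)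

/-- The basis vector labelled by `A`, or zero if `A` is not in the index set. -/
def vec (A : ZMat) : V := if h : A ∈ XiZ m n d then b ⟨A, h⟩ else 0

theorem vec_of_mem {A : ZMat} (h : A ∈ XiZ m n d) : vec b A = b ⟨A, h⟩ := dif_pos h

theorem ext_vec {f g : Module.End K V} (h : ∀ A ∈ XiZ m n d, f (vec b A) = g (vec b A)) :
    f = g :=
  b.ext fun A => by simpa only [vec_of_mem b A.2] using h A A.2

/-- The normalized operator moving units from row `p` to row `p + 1`. -/
def raise (p : ℤ) : Module.End K V :=
  b.constr K fun A => ∑ j ∈ Finset.Icc (-(n : ℤ)) n, coef n p j A • vec b (A.1 + rowMove p j)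

/-- The operator which is diagonal in the given basis. -/
def diag (f : ZMat → K) : Module.End K V := b.constr K fun A => f A • b A

/-- The integer weight of a matrix with respect to row `r`. -/
def wt (n : ℕ) (r : ℤ) (A : ZMat) : ℤ :=
  if r = 0 then (rowSum n 0 A - 1) / 2 else rowSum n r A

/-- The Cartan operators. -/
def torus (r e : ℤ) : Module.End K V := diag b fun A => q ^ (e * wt n r A)

/-- The generators of the left action, normalized. -/
def gens : Set (Module.End K V) :=
  {O | (∃ p : ℤ, -(m : ℤ) ≤ p ∧ p < m ∧ O = raise b p) ∨
    ∃ r : ℤ, 0 ≤ r ∧ r ≤ m ∧ (O = torus b r 1 ∨ O = torus b r (-1))}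

theorem raise_vec {A : ZMat} (hA : A ∈ XiZ m n d) (p : ℤ) : raise b p (vec b A)
    = ∑ j ∈ Finset.Icc (-(n : ℤ)) n, coef n p j A • vec b (A + rowMove p j) := by
  rw [vec_of_mem b hA, raise, Module.Basis.constr_basis]

theorem diag_vec (f : ZMat → K) (A : ZMat) : diag b f (vec b A) = f A • vec b A := by
  by_cases hA : A ∈ XiZ m n d
  · rw [vec_of_mem b hA, diag, Module.Basis.constr_basis]
  · rw [vec, dif_neg hA, map_zero, smul_zero]

variable (b' : Module.Basis (XiZ n m d) K V)

theorem raise_tr_vec (hb : ∀ A, vec b' (trZ A) = vec b A) {A : ZMat} (hA : A ∈ XiZ m n d) (r : ℤ) :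
    raise b' r (vec b A) = ∑ i ∈ Finset.Icc (-(m : ℤ)) m,
      coef m r i (trZ A) • vec b (A + trZ (rowMove r i)) := by
  rw [← hb, raise_vec b' (trZ_mem_XiZ hA)]
  refine Finset.sum_congr rfl fun i _ => ?_
  rw [← hb, trZ_add, trZ_trZ]

theorem coef_eq_zero_of_cnt {n : ℕ} {p j : ℤ} {A : ZMat} (h : cnt p j A = 0) : coef n p j A = 0 := by
  rw [coef, h, qint_zero, mul_zero]

theorem coef_ne_zero {n : ℕ} {p j : ℤ} {A : ZMat} (h : cnt p j A ≠ 0) : coef n p j A ≠ 0 :=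
  mul_ne_zero (q_zpow_ne_zero _) (qint_ne_zero h)

theorem add_colMove_mem {A : ZMat} (hA : A ∈ XiZ m n d) {r i : ℤ} (hr : -(n : ℤ) ≤ r)
    (hr' : r < n) (hi : -(m : ℤ) ≤ i) (hi' : i ≤ m) (hc : cnt r i (trZ A) ≠ 0) :
    A + trZ (rowMove r i) ∈ XiZ m n d :=
  trZ_mem_XiZ (add_rowMove_mem (trZ_mem_XiZ hA) hr hr' hi hi' hc)

theorem raise_raise_vec (hb : ∀ A, vec b' (trZ A) = vec b A) {A : ZMat} (hA : A ∈ XiZ m n d)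
    {p r : ℤ} (hr : -(n : ℤ) ≤ r) (hr' : r < n) :
    raise b p (raise b' r (vec b A)) = ∑ i ∈ Finset.Icc (-(m : ℤ)) m,
      ∑ j ∈ Finset.Icc (-(n : ℤ)) n,
      (coef m r i (trZ A) * coef n p j (A + trZ (rowMove r i)))
        • vec b (A + trZ (rowMove r i) + rowMove p j) := by
  rw [raise_tr_vec b b' hb hA, map_sum]
  refine Finset.sum_congr rfl fun i hi => ?_
  rw [Finset.mem_Icc] at hi
  rw [map_smul]
  by_cases hc : cnt r i (trZ A) = 0
  · simp [coef_eq_zero_of_cnt hc]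
  · rw [raise_vec b (add_colMove_mem hA hr hr' hi.1 hi.2 hc), Finset.smul_sum]
    simp only [smul_smul]

theorem eTh_neg (x y : ℤ) : eTh (-x) (-y) = eTh x y := by
  funext s t
  simp only [eTh, neg_neg]
  exact add_comm _ _

theorem colMove_add_rowMove (p r : ℤ) : trZ (rowMove r p) + rowMove p (r + 1)
    = trZ (rowMove r (p + 1)) + rowMove p r := by
  rw [trZ_rowMove, trZ_rowMove, rowMove, rowMove]; abel

theorem colMove_add_rowMove_neg (p r : ℤ) : trZ (rowMove r (-p)) + rowMove p (-r - 1)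
    = trZ (rowMove r (-p - 1)) + rowMove p (-r) := by
  have h1 := eTh_neg p (-r - 1)
  have h2 := eTh_neg p (-r)
  have h3 := eTh_neg (p + 1) (-r - 1)
  have h4 := eTh_neg (p + 1) (-r)
  rw [neg_neg] at h2 h4
  rw [show -(-r - 1) = r + 1 by ring] at h1 h3
  rw [neg_add'] at h3 h4
  rw [trZ_rowMove, trZ_rowMove, rowMove, rowMove, h1, h2, h3, h4]; abel

theorem sum_sum_ite_smul {s t : Finset ℤ} {x y : ℤ} (hx : x ∈ s) (hy : y ∈ t) (c : K)
    (X : ℤ → ℤ → V) :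
    ∑ i ∈ s, ∑ j ∈ t, (if i = x ∧ j = y then c else 0) • X i j = c • X x y := by
  rw [Finset.sum_eq_single_of_mem x hx, Finset.sum_eq_single_of_mem y hy]
  · simp
  · intro j _ hj; simp [hj]
  · intro i _ hi; simp [hi]

theorem commute_raise (hb : ∀ A, vec b' (trZ A) = vec b A) {p r : ℤ} (hp : -(m : ℤ) ≤ p)
    (hp' : p < m) (hr : -(n : ℤ) ≤ r) (hr' : r < n) : Commute (raise b p) (raise b' r) := by
  refine ext_vec b fun A hA => ?_
  simp only [Module.End.mul_apply]
  have hb' : ∀ A, vec b (trZ A) = vec b' A := fun A => by rw [← hb, trZ_trZ]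
  have hrev := raise_raise_vec b' b hb' (trZ_mem_XiZ hA) (p := r) hp hp'
  rw [hb] at hrev
  rw [raise_raise_vec b b' hb hA hr hr', hrev, Finset.sum_comm, ← sub_eq_zero,
    ← Finset.sum_sub_distrib]
  have hX (i j : ℤ) : vec b' (trZ A + trZ (rowMove p j) + rowMove r i)
      = vec b (A + trZ (rowMove r i) + rowMove p j) := by
    rw [← hb, trZ_add, trZ_add, trZ_trZ]; congr 1; abel
  simp only [trZ_trZ, hX, ← Finset.sum_sub_distrib, ← sub_smul]
  rw [Finset.sum_comm]
  have hg (i j : ℤ) := gap_eq (i := i) (j := j) hp hp' hr hr' hA.2.2.1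
  simp only [gap] at hg
  simp only [hg, sub_smul, add_smul, Finset.sum_sub_distrib, Finset.sum_add_distrib]
  rw [sum_sum_ite_smul, sum_sum_ite_smul, sum_sum_ite_smul, sum_sum_ite_smul, add_assoc A,
    colMove_add_rowMove, add_assoc A (trZ (rowMove r (-p))), colMove_add_rowMove_neg]
  · simp only [add_assoc, sub_self, zero_add]
  all_goals simp only [Finset.mem_Icc]; omega

theorem commute_diag_raise (hb : ∀ A, vec b' (trZ A) = vec b A) (r : ℤ)
    (f : ZMat → K) (hf : ∀ i A, f (A + trZ (rowMove r i)) = f A) :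
    Commute (diag b f) (raise b' r) := by
  refine ext_vec b fun A hA => ?_
  simp only [Module.End.mul_apply]
  rw [diag_vec, raise_tr_vec b b' hb hA, map_smul, raise_tr_vec b b' hb hA, map_sum,
    Finset.smul_sum]
  refine Finset.sum_congr rfl fun i _ => ?_
  rw [map_smul, diag_vec, hf, smul_comm]

theorem wt_add_colMove (n : ℕ) (r i s : ℤ) (A : ZMat) (hr : -(n : ℤ) ≤ r) (hr' : r < n) :
    wt n s (A + trZ (rowMove r i)) = wt n s A := by
  simp only [wt, rowSum_add_colMove n r i _ A hr hr']

theorem commute_diag_diag (hb : ∀ A, vec b' (trZ A) = vec b A) (f g : ZMat → K) :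
    Commute (diag b f) (diag b' g) := by
  refine ext_vec b fun A hA => ?_
  simp only [Module.End.mul_apply]
  rw [diag_vec, map_smul, ← hb, diag_vec, map_smul, hb, diag_vec, smul_comm]

theorem commute_gens (hb : ∀ A, vec b' (trZ A) = vec b A) {x y : Module.End K V}
    (hx : x ∈ gens b) (hy : y ∈ gens b') : Commute x y := by
  have hb' : ∀ A, vec b (trZ A) = vec b' A := fun A => by rw [← hb, trZ_trZ]
  rcases hx with ⟨p, hp, hp', rfl⟩ | ⟨s, hs, hs', hx⟩
  · rcases hy with ⟨r, hr, hr', rfl⟩ | ⟨t, ht, ht', hy⟩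
    · exact commute_raise b b' hb hp hp' hr hr'
    · have (e : ℤ) : Commute (raise b p) (torus b' t e) :=
        (commute_diag_raise b' b hb' p _ fun i A => by rw [wt_add_colMove m p i t A hp hp']).symm
      rcases hy with rfl | rfl <;> exact this _
  · rcases hy with ⟨r, hr, hr', rfl⟩ | ⟨t, ht, ht', hy⟩
    · have (e : ℤ) : Commute (torus b s e) (raise b' r) :=
        commute_diag_raise b b' hb r _ fun i A => by rw [wt_add_colMove n r i s A hr hr']
      rcases hx with rfl | rfl <;> exact this _
    · rcases hx with rfl | rfl <;> rcases hy with rfl | rfl <;> exact commute_diag_diag b b' hb _ _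

end Operators

/-- The diagonal matrix of column sums. -/
def colDiag (m : ℕ) (A : ZMat) : ZMat := fun i j => if i = j then rowSum m j (trZ A) else 0

/-- The weighted distance of a matrix from the diagonal. -/
def spread (m n : ℕ) (A : ZMat) : ℤ :=
  ∑ i ∈ Finset.Icc (-(m : ℤ)) m, ∑ j ∈ Finset.Icc (-(n : ℤ)) n, A i j * (i - j) ^ 2

theorem spread_add (m n : ℕ) (A B : ZMat) : spread m n (A + B) = spread m n A + spread m n B := by
  simp only [spread, Pi.add_apply, add_mul, Finset.sum_add_distrib]

theorem spread_sub (m n : ℕ) (A B : ZMat) : spread m n (A - B) = spread m n A - spread m n B := by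
  simp only [spread, Pi.sub_apply, sub_mul, Finset.sum_sub_distrib]

theorem spread_eTh {m n : ℕ} {x y : ℤ} (hx : -(m : ℤ) ≤ x) (hx' : x ≤ m) (hy : -(n : ℤ) ≤ y)
    (hy' : y ≤ n) : spread m n (eTh x y) = 2 * (x - y) ^ 2 := by
  have h1 : -x ≤ m := by omega
  have h2 : -y ≤ n := by omega
  simp only [spread, eTh, add_mul, ite_mul, one_mul, zero_mul, ite_and, Finset.sum_add_distrib,
    Finset.sum_ite_irrel, Finset.sum_const_zero, Finset.sum_ite_eq', Finset.mem_Icc, neg_le_neg_iff,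
    h1, h2, hx, hx', hy, hy', and_self, if_true]
  ring

theorem spread_nonneg {m n d : ℕ} {A : ZMat} (hA : A ∈ XiZ m n d) : 0 ≤ spread m n A :=
  Finset.sum_nonneg fun i _ => Finset.sum_nonneg fun j _ => mul_nonneg (hA.1 i j) (sq_nonneg _)

theorem spread_rowMove {m n : ℕ} {p j : ℤ} (hp : -(m : ℤ) ≤ p) (hp' : p < m) (hj : -(n : ℤ) ≤ j)
    (hj' : j ≤ n) : spread m n (rowMove p j) = 4 * (p - j) + 2 := by
  rw [rowMove, spread_sub, spread_eTh (by omega) (by omega) hj hj', spread_eTh hp hp'.le hj hj']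
  ring

theorem rowMove_neg (p j : ℤ) : rowMove (-p - 1) (-j) = -rowMove p j := by
  rw [rowMove, rowMove, sub_add_cancel, eTh_neg, ← neg_add', eTh_neg, neg_sub]

theorem colDiag_add_rowMove {m : ℕ} {p j : ℤ} (A : ZMat) (hp : -(m : ℤ) ≤ p) (hp' : p < m) :
    colDiag m (A + rowMove p j) = colDiag m A := by
  funext x y
  simp only [colDiag]
  rw [trZ_add, rowSum_add_colMove m p j y (trZ A) hp hp']

theorem eq_colDiag {m n d : ℕ} {A : ZMat} (hA : A ∈ XiZ m n d) (h : ∀ i j, j < i → A i j = 0) :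
    A = colDiag m A := by
  have h' : ∀ i j, i ≠ j → A i j = 0 := by
    intro i j hij
    rcases lt_or_gt_of_ne hij with hlt | hlt
    · rw [← hA.2.2.1]; exact h _ _ (by omega)
    · exact h i j hlt
  funext i j
  simp only [colDiag, rowSum, trZ]
  split_ifs with hij
  · subst hij
    by_cases hi : i ∈ Finset.Icc (-(m : ℤ)) m
    · exact (Finset.sum_eq_single_of_mem i hi fun k _ hk => h' k i hk).symm
    · rw [Finset.sum_eq_zero fun k hk => h' k i (by rintro rfl; exact hi hk)]
      by_contra h0
      exact hi (Finset.mem_Icc.2 (hA.2.1 i i h0).1)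
  · exact h' i j hij

theorem bound_add_rowMove {N : ℤ} {A : ZMat} (h : ∀ x y, A x y ≠ 0 → -N ≤ y ∧ y ≤ N) (p : ℤ) {j : ℤ}
    (hj : -N ≤ j ∧ j ≤ N) : ∀ x y, (A + rowMove p j) x y ≠ 0 → -N ≤ y ∧ y ≤ N := by
  intro x y hxy
  by_cases h0 : A x y = 0
  · by_cases h1 : y = j
    · omega
    by_cases h2 : y = -j
    · omega
    · exact absurd (by simp [rowMove, eTh, h0, h1, h2]) hxy
  · exact h x y h0

section Generation

variable {V : Type*} [AddCommGroup V] [Module K V] {m n d : ℕ} (b : Module.Basis (XiZ m n d) K V)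

theorem raise_mem_adjoin {p : ℤ} (hp : -(m : ℤ) ≤ p) (hp' : p < m) :
    raise b p ∈ Algebra.adjoin K (gens b) :=
  Algebra.subset_adjoin (Or.inl ⟨p, hp, hp', rfl⟩)

/-- The vectors obtained from `v` by acting with the algebra generated by `gens b`. -/
def orbit (v : V) : Submodule K V :=
  (Subalgebra.toSubmodule (Algebra.adjoin K (gens b))).map (LinearMap.applyₗ v)

theorem mem_orbit {v w : V} : w ∈ orbit b v ↔ ∃ a ∈ Algebra.adjoin K (gens b), a v = w := Iff.rfl

theorem apply_mem_orbit {v w : V} {a : Module.End K V} (ha : a ∈ Algebra.adjoin K (gens b))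
    (hw : w ∈ orbit b v) : a w ∈ orbit b v := by
  rw [mem_orbit] at hw ⊢
  obtain ⟨c, hc, rfl⟩ := hw
  exact ⟨a * c, mul_mem ha hc, rfl⟩

theorem exists_min_lower {A : ZMat} (hA : A ∈ XiZ m n d) (h : ¬∀ i j, j < i → A i j = 0) :
    ∃ i j, j < i ∧ A i j ≠ 0 ∧ ∀ i' j', j' < j → j' < i' → A i' j' = 0 := by
  push Not at h
  let s := (Finset.Icc (-(n : ℤ)) n).filter fun j => ∃ i, j < i ∧ A i j ≠ 0
  have hs : ∀ i j, j < i → A i j ≠ 0 → j ∈ s := fun i j hij h0 =>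
    Finset.mem_filter.2 ⟨Finset.mem_Icc.2 (hA.2.1 i j h0).2, i, hij, h0⟩
  obtain ⟨i, j, hij, h0⟩ := h
  obtain ⟨j₀, hj₀, hmin⟩ := s.exists_minimal ⟨j, hs i j hij h0⟩
  obtain ⟨i₀, h1, h2⟩ := (Finset.mem_filter.1 hj₀).2
  refine ⟨i₀, j₀, h1, h2, fun i' j' hlt hlt' => ?_⟩
  by_contra h3
  exact absurd (hmin (hs i' j' hlt' h3) hlt.le) (by omega)

theorem vec_mem_orbit {A : ZMat} (hA : A ∈ XiZ m n d)
    (hbd : ∀ i j, A i j ≠ 0 → -(m : ℤ) ≤ j ∧ j ≤ m) :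
    vec b A ∈ orbit b (vec b (colDiag m A)) := by
  induction hk : (spread m n A).toNat using Nat.strong_induction_on generalizing A with
  | _ k ih =>
  have hs := spread_nonneg hA
  by_cases hdiag : ∀ i j, j < i → A i j = 0
  · rw [← eq_colDiag hA hdiag]
    exact ⟨1, one_mem (Algebra.adjoin K (gens b)), rfl⟩
  obtain ⟨i, j, hij, h0, hmin⟩ := exists_min_lower hA hdiag
  obtain ⟨⟨hi, hi'⟩, hj, hj'⟩ := hA.2.1 i j h0
  have hjm := hbd i j h0
  obtain ⟨p, rfl⟩ : ∃ p, i = p + 1 := ⟨i - 1, by ring⟩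
  have hp : -(m : ℤ) ≤ p := by omega
  have hp' : p < m := by omega
  set A' := A + rowMove (-p - 1) (-j) with hA'def
  have hA' : A' ∈ XiZ m n d := by
    refine add_rowMove_mem hA (by omega) (by omega) (by omega) (by omega) ?_
    have := hA.2.2.1 (p + 1) j
    rw [neg_add'] at this
    rw [cnt, this, if_neg (by omega), sub_zero]
    exact h0
  have hbd' := bound_add_rowMove hbd (-p - 1) (j := -j) (by omega)
  rw [← hA'def] at hbd'
  have hback : A' + rowMove p j = A := by rw [hA'def, rowMove_neg]; abel
  have hs' := spread_nonneg hA'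
  have hspr : spread m n A = spread m n A' + (4 * (p - j) + 2) := by
    rw [← spread_rowMove hp hp' hj hj', ← spread_add, hback]
  have hcol : colDiag m A' = colDiag m A := by
    rw [← hback, colDiag_add_rowMove _ hp hp']
  have hmem := apply_mem_orbit b (raise_mem_adjoin b hp hp') (ih _ (by omega) hA' hbd' rfl)
  rw [hcol, raise_vec b hA',
    ← Finset.add_sum_erase _ _ (Finset.mem_Icc.2 ⟨hj, hj'⟩ : j ∈ Finset.Icc (-(n : ℤ)) n), hback]
    at hmem
  have hA'row (j' : ℤ) (hjj : j' ≤ j) : cnt p j' A' = A p j' + if j' = j then 1 else 0 := by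
    rw [hA'def, rowMove_neg]
    simp only [cnt, Pi.add_apply, Pi.neg_apply, rowMove, Pi.sub_apply, eTh, true_and]
    split_ifs <;> omega
  have hrest : ∑ j' ∈ (Finset.Icc (-(n : ℤ)) n).erase j,
      coef n p j' A' • vec b (A' + rowMove p j') ∈ orbit b (vec b (colDiag m A)) := by
    refine Submodule.sum_mem _ fun j' hj'' => ?_
    obtain ⟨hne, hj1⟩ := Finset.mem_erase.1 hj''
    obtain ⟨hj1, hj2⟩ := Finset.mem_Icc.1 hj1
    by_cases hc : cnt p j' A' = 0
    · rw [coef_eq_zero_of_cnt hc, zero_smul]; exact zero_mem _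
    have hlt : j < j' := by
      by_contra hle
      rw [hA'row j' (by omega), if_neg hne, add_zero, hmin _ _ (by omega) (by omega)] at hc
      exact hc rfl
    have hmem' := add_rowMove_mem hA' hp hp' hj1 hj2 hc
    have hspr' := spread_nonneg hmem'
    rw [spread_add, spread_rowMove hp hp' hj1 hj2] at hspr'
    have := ih _ ?_ hmem' (bound_add_rowMove hbd' p ?_) rfl
    · rw [colDiag_add_rowMove _ hp hp', hcol] at this
      exact Submodule.smul_mem _ _ this
    · rw [spread_add, spread_rowMove hp hp' hj1 hj2]; omega
    · by_cases h00 : p = 0 ∧ j' = 0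
      · omega
      · rw [cnt, if_neg h00, sub_zero] at hc
        exact hbd' _ _ hc
  have hcne : coef n p j A' ≠ 0 := by
    refine coef_ne_zero ?_
    have := hA.1 p j
    rw [hA'row j le_rfl, if_pos rfl]; omega
  have := Submodule.sub_mem _ hmem hrest
  rw [add_sub_cancel_right] at this
  exact (Submodule.smul_mem_iff _ hcne).1 this

end Generation

/-- A subalgebra of endomorphisms closed under adjoints with respect to an anisotropic symmetric
bilinear form acts semisimply. -/
theorem isSemisimpleModule_of_adjoint {k V : Type*} [Field k] [AddCommGroup V] [Module k V]
    [FiniteDimensional k V] (S : Subalgebra k (Module.End k V)) (B : LinearMap.BilinForm k V)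
    (hB : ∀ v w, B v w = B w v) (haniso : ∀ v, B v v = 0 → v = 0)
    (hadj : ∀ a ∈ S, ∃ a' ∈ S, ∀ v w, B (a v) w = B v (a' w)) : IsSemisimpleModule S V := by
  have hrefl : B.IsRefl := fun v w h => by rw [hB, h]
  rw [isSemisimpleModule_iff]
  refine ⟨fun W => ?_⟩
  let U : Submodule S V :=
    { carrier := {v | ∀ w ∈ W, B w v = 0}
      add_mem' := fun {x y} hx hy w hw => by rw [map_add, hx w hw, hy w hw, add_zero]
      zero_mem' := fun w _ => map_zero _
      smul_mem' := fun a v hv w hw => by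
        obtain ⟨a', ha', h⟩ := hadj a.1 a.2
        have : a • v = a.1 v := rfl
        rw [this, hB, h, hB]
        exact hv _ (W.smul_mem ⟨a', ha'⟩ hw) }
  have hU : U.restrictScalars k = B.orthogonal (W.restrictScalars k) := by
    ext v; rfl
  have hdisj : Disjoint (W.restrictScalars k) (B.orthogonal (W.restrictScalars k)) := by
    rw [Submodule.disjoint_def]
    exact fun x hx hx' => haniso x (hx' x hx)
  have hcompl := (LinearMap.BilinForm.isCompl_orthogonal_iff_disjoint hrefl).2 hdisj
  rw [← hU] at hcompl
  refine ⟨U, ?_, ?_⟩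
  · rw [Submodule.disjoint_def]
    exact fun x hx hx' => Submodule.disjoint_def.1 hcompl.1 x hx hx'
  · rw [codisjoint_iff, Submodule.eq_top_iff']
    intro x
    have hx : x ∈ W.restrictScalars k ⊔ U.restrictScalars k := by
      rw [codisjoint_iff.1 hcompl.2]; trivial
    obtain ⟨y, hy, z, hz, h⟩ := Submodule.mem_sup.1 hx
    exact Submodule.mem_sup.2 ⟨y, hy, z, hz, h⟩

/-- The double commutant theorem for semisimple algebras of endomorphisms. -/
theorem centralizer_centralizer_of_isSemisimpleModule {k V : Type*} [Field k] [AddCommGroup V]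
    [Module k V] [FiniteDimensional k V] (S : Subalgebra k (Module.End k V))
    [IsSemisimpleModule S V] :
    Subalgebra.centralizer k (Subalgebra.centralizer k (S : Set (Module.End k V)) :
      Set (Module.End k V)) = S := by
  refine le_antisymm (fun z hz => ?_) (fun z hz => ?_)
  · let f : Module.End (Module.End S V) V :=
      { toFun := z
        map_add' := map_add z
        map_smul' := fun g x => by
          have hg : g.restrictScalars k ∈ Subalgebra.centralizer k (S : Set (Module.End k V)) := by
            rw [Subalgebra.mem_centralizer_iff]
            intro a ha
            ext v
            exact (g.map_smul (⟨a, ha⟩ : S) v).symm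
          have := (Subalgebra.mem_centralizer_iff k).1 hz _ hg
          exact (LinearMap.congr_fun this x).symm }
    let e := Module.finBasis k V
    obtain ⟨r, hr⟩ := jacobson_density (R := S) f (Finset.univ.image e)
    have : z = r.1 := e.ext fun i => hr (e i) (Finset.mem_image_of_mem _ (Finset.mem_univ i))
    rw [this]; exact r.2
  · rw [Subalgebra.mem_centralizer_iff]
    intro g hg
    exact ((Subalgebra.mem_centralizer_iff k).1 hg z hz).symm

theorem entry_le {m n d : ℕ} {A : ZMat} (hA : A ∈ XiZ m n d) (i j : ℤ) : A i j ≤ 2 * d + 1 := by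
  by_cases h : A i j = 0
  · rw [h]; positivity
  obtain ⟨hi, hj⟩ := hA.2.1 i j h
  rw [← hA.2.2.2]
  refine (Finset.single_le_sum (f := A i) (fun k _ => hA.1 i k) (Finset.mem_Icc.2 hj)).trans ?_
  exact Finset.single_le_sum (f := fun i => ∑ j ∈ Finset.Icc (-(n : ℤ)) n, A i j)
    (fun k _ => Finset.sum_nonneg fun l _ => hA.1 k l) (Finset.mem_Icc.2 hi)

instance finite_XiZ (m n d : ℕ) : Finite (XiZ m n d) := by
  let f : XiZ m n d → (Finset.Icc (-(m : ℤ)) m × Finset.Icc (-(n : ℤ)) n →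
      Finset.Icc (0 : ℤ) (2 * d + 1)) := fun A c =>
    ⟨A.1 c.1 c.2, Finset.mem_Icc.2 ⟨A.2.1 _ _, entry_le A.2 _ _⟩⟩
  refine Finite.of_injective f fun A B h => Subtype.ext ?_
  funext i j
  by_cases hc : i ∈ Finset.Icc (-(m : ℤ)) m ∧ j ∈ Finset.Icc (-(n : ℤ)) n
  · exact congrArg Subtype.val (congrFun h (⟨i, hc.1⟩, ⟨j, hc.2⟩))
  · have hz {A : ZMat} (hA : A ∈ XiZ m n d) : A i j = 0 := by
      by_contra h0
      obtain ⟨hi, hj⟩ := hA.2.1 i j h0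
      exact hc ⟨Finset.mem_Icc.2 hi, Finset.mem_Icc.2 hj⟩
    rw [hz A.2, hz B.2]

/-- The factor by which the norm of a basis vector changes when an entry `a` is increased. -/
def stepNorm (a : ℤ) : K := qint (a + 1) * q ^ (-a)

/-- The contribution of an off-centre entry to the norm of a basis vector. -/
def entryNorm (a : ℤ) : K := ∏ k ∈ Finset.range a.toNat, stepNorm k

/-- The contribution of the central entry to the norm of a basis vector. -/
def centreNorm (a : ℤ) : K := ∏ k ∈ Finset.range ((a - 1) / 2).toNat, stepNorm (2 * k + 1)

/-- Representatives for the cells other than the centre, up to central symmetry. -/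
def halfCells (m n : ℕ) : Finset (ℤ × ℤ) :=
  (Finset.Icc (-(m : ℤ)) m ×ˢ Finset.Icc (-(n : ℤ)) n).filter
    fun c => 0 < c.1 ∨ c.1 = 0 ∧ 0 < c.2

/-- The norm of the basis vector labelled by `A`. -/
def vecNorm (m n : ℕ) (A : ZMat) : K :=
  centreNorm (A 0 0) * ∏ c ∈ halfCells m n, entryNorm (A c.1 c.2)

theorem entryNorm_succ {a : ℤ} (ha : 0 ≤ a) : entryNorm (a + 1) = entryNorm a * stepNorm a := by
  lift a to ℕ using ha
  rw [entryNorm, entryNorm, show ((a : ℤ) + 1).toNat = a + 1 by omega, Finset.prod_range_succ]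
  simp

theorem centreNorm_add_two {a : ℤ} (ha : 0 ≤ a) (h : ∃ c, a = 2 * c + 1) :
    centreNorm (a + 2) = centreNorm a * stepNorm a := by
  obtain ⟨c, rfl⟩ := h
  lift c to ℕ using (by omega)
  rw [centreNorm, centreNorm, show ((2 * (c : ℤ) + 1 + 2 - 1) / 2).toNat = c + 1 by omega,
    show ((2 * (c : ℤ) + 1 - 1) / 2).toNat = c by omega, Finset.prod_range_succ]

theorem realEval_stepNorm_pos {φ : K →+* ℝ} (h : 0 < φ q) (k : ℕ) : 0 < φ (stepNorm k) := by
  rw [stepNorm, map_mul, map_zpow₀]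
  have := realEval_qint_pos h k
  have := zpow_pos h (-(k : ℤ))
  positivity

theorem realEval_vecNorm_pos {φ : K →+* ℝ} (h : 0 < φ q) (m n : ℕ) (A : ZMat) :
    0 < φ (vecNorm m n A) := by
  simp only [vecNorm, centreNorm, entryNorm, map_mul, map_prod]
  refine mul_pos (Finset.prod_pos fun k _ => ?_)
    (Finset.prod_pos fun c _ => Finset.prod_pos fun k _ => realEval_stepNorm_pos h k)
  exact_mod_cast realEval_stepNorm_pos h (2 * k + 1)

theorem vecNorm_add_eTh_of_mem {m n : ℕ} {A : ZMat} {x y : ℤ} (h0 : 0 ≤ A x y)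
    (hmem : (x, y) ∈ halfCells m n) :
    vecNorm m n (A + eTh x y) = vecNorm m n A * stepNorm (A x y) := by
  obtain ⟨-, hxy⟩ := Finset.mem_filter.1 hmem
  simp only at hxy
  rw [vecNorm, vecNorm, ← Finset.mul_prod_erase _ _ hmem, ← Finset.mul_prod_erase _ _ hmem]
  have h1 : (A + eTh x y) 0 0 = A 0 0 := by
    simp only [Pi.add_apply, eTh]; split_ifs <;> omega
  have h2 : (A + eTh x y) x y = A x y + 1 := by
    simp only [Pi.add_apply, eTh, true_and]; split_ifs <;> omega
  rw [h1, h2, entryNorm_succ h0, Finset.prod_congr rfl (fun c hc => ?_)]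
  · ring
  · obtain ⟨hne, hc⟩ := Finset.mem_erase.1 hc
    obtain ⟨-, hc'⟩ := Finset.mem_filter.1 hc
    rw [Ne, Prod.ext_iff] at hne
    congr 1
    simp only [Pi.add_apply, eTh]
    simp only at hne
    split_ifs <;> omega

theorem vecNorm_add_eTh {m n : ℕ} {A : ZMat} {x y : ℤ} (h0 : 0 ≤ A x y)
    (hodd : ∃ c, A 0 0 = 2 * c + 1) (hsymm : A (-x) (-y) = A x y)
    (hx : -(m : ℤ) ≤ x) (hx' : x ≤ m) (hy : -(n : ℤ) ≤ y) (hy' : y ≤ n) :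
    vecNorm m n (A + eTh x y) = vecNorm m n A * stepNorm (A x y) := by
  by_cases hc : x = 0 ∧ y = 0
  · obtain ⟨rfl, rfl⟩ := hc
    have h1 : (A + eTh 0 0) 0 0 = A 0 0 + 2 := by simp [eTh]
    rw [vecNorm, vecNorm, h1, centreNorm_add_two h0 hodd, Finset.prod_congr rfl (fun c hc => ?_)]
    · ring
    · obtain ⟨-, hc'⟩ := Finset.mem_filter.1 hc
      congr 1
      simp only [Pi.add_apply, eTh]
      split_ifs <;> omega
  by_cases hpos : 0 < x ∨ x = 0 ∧ 0 < y
  · refine vecNorm_add_eTh_of_mem h0 ?_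
    simp only [halfCells, Finset.mem_filter, Finset.mem_product, Finset.mem_Icc]
    omega
  · rw [← hsymm, ← eTh_neg]
    refine vecNorm_add_eTh_of_mem (by rwa [hsymm]) ?_
    simp only [halfCells, Finset.mem_filter, Finset.mem_product, Finset.mem_Icc]
    omega

theorem eTh_apply_neg (r c s t : ℤ) : eTh r c (-s) (-t) = eTh r c s t := by
  simp only [eTh, neg_eq_iff_eq_neg, neg_neg]
  exact add_comm (G := ℤ) _ _

theorem expo_neg_rowMove {n : ℕ} {A : ZMat} {p j : ℤ} (hp : 0 ≤ p) (hj : -(n : ℤ) ≤ j)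
    (hj' : j ≤ n) (hA : ∀ i j, A (-i) (-j) = A i j) :
    expo n (-p - 1) (-j) (A + rowMove p j)
      = expo n p j A - (rowSum n p A - rowSum n (p + 1) A) + (A p j - A (p + 1) j)
        + (if p = 0 then 1 else 0) - (if p = 0 ∧ j = 0 then 1 else 0) := by
  have hE : expo n (-p - 1) (-j) (A + rowMove p j)
      = ∑ k ∈ Finset.Ioc j n, ((A + rowMove p j) (p + 1) k - (A + rowMove p j) p k) := by
    rw [expo, if_neg (by omega), sub_zero]
    refine Finset.sum_nbij' (fun k => -k) (fun k => -k) ?_ ?_ ?_ ?_ ?_ <;>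
      simp only [Finset.mem_Ico, Finset.mem_Ioc, neg_neg, implies_true]
    · intro k hk; omega
    · intro k hk; omega
    · intro k hk
      have h1 := hA (p + 1) (-k)
      have h2 := hA p (-k)
      have h3 (s t : ℤ) : rowMove p j (-s) (-t) = rowMove p j s t := by
        simp only [rowMove, Pi.sub_apply, eTh_apply_neg]
      have h4 := h3 (p + 1) (-k)
      have h5 := h3 p (-k)
      rw [neg_neg] at h1 h2 h4 h5
      rw [neg_add'] at h1 h4
      rw [sub_add_cancel, Pi.add_apply, Pi.add_apply, Pi.add_apply, Pi.add_apply, Pi.add_apply,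
        Pi.add_apply, Pi.add_apply, Pi.add_apply, h1, h2, h4, h5]
  have hM : ∑ k ∈ Finset.Ioc j n, (rowMove p j (p + 1) k - rowMove p j p k)
      = if p = 0 ∧ j < 0 then 1 else 0 := by
    rw [Finset.sum_congr rfl (g := fun k => if k = -j then (if p = 0 then 1 else 0) else 0)]
    · simp only [Finset.sum_ite_eq', Finset.mem_Ioc]
      split_ifs <;> omega
    · intro k hk
      rw [Finset.mem_Ioc] at hk
      simp only [rowMove, Pi.sub_apply, eTh, true_and]
      split_ifs <;> omega
  have hT : rowSum n p A - rowSum n (p + 1) A = ∑ k ∈ Finset.Ico (-(n : ℤ)) j, (A p k - A (p + 1) k)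
      + (A p j - A (p + 1) j) + ∑ k ∈ Finset.Ioc j n, (A p k - A (p + 1) k) := by
    have hI : Finset.Icc (-(n : ℤ)) n
        = (insert j (Finset.Ico (-(n : ℤ)) j)) ∪ Finset.Ioc j n := by
      ext k
      simp only [Finset.mem_Icc, Finset.mem_union, Finset.mem_insert, Finset.mem_Ico,
        Finset.mem_Ioc]
      omega
    rw [rowSum, rowSum, ← Finset.sum_sub_distrib, hI, Finset.sum_union, Finset.sum_insert]
    · ring
    · simp
    · rw [Finset.disjoint_left]
      intro k
      simp only [Finset.mem_insert, Finset.mem_Ico, Finset.mem_Ioc]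
      omega
  have hS : ∑ k ∈ Finset.Ioc j n, ((A + rowMove p j) (p + 1) k - (A + rowMove p j) p k)
      = -∑ k ∈ Finset.Ioc j n, (A p k - A (p + 1) k)
        + ∑ k ∈ Finset.Ioc j n, (rowMove p j (p + 1) k - rowMove p j p k) := by
    rw [← Finset.sum_neg_distrib, ← Finset.sum_add_distrib]
    refine Finset.sum_congr rfl fun k _ => ?_
    simp only [Pi.add_apply]; ring
  rw [hE, hS, hM, hT, expo]
  split_ifs <;> omega

/-- The diagonal correction relating a raising operator to the adjoint of its mirror image. -/
def kappa (n : ℕ) (p : ℤ) (A : ZMat) : ℤ :=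
  rowSum n p A - rowSum n (p + 1) A - 1 - if p = 0 then 1 else 0

theorem vecNorm_mul_coef {m n d : ℕ} {A : ZMat} {p j : ℤ} (hA : A ∈ XiZ m n d)
    (hA' : A + rowMove p j ∈ XiZ m n d) (hp : 0 ≤ p) (hp' : p < m) (hj : -(n : ℤ) ≤ j)
    (hj' : j ≤ n) : vecNorm m n (A + rowMove p j) * coef n p j A
      = vecNorm m n A * (coef n (-p - 1) (-j) (A + rowMove p j) * q ^ kappa n p A) := by
  set C := A - eTh p j with hC
  have h1 : A = C + eTh p j := by rw [hC]; abel
  have h2 : A + rowMove p j = C + eTh (p + 1) j := by rw [hC, rowMove]; abel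
  have hCsymm (i j : ℤ) : C (-i) (-j) = C i j := by
    rw [hC, Pi.sub_apply, Pi.sub_apply, Pi.sub_apply, Pi.sub_apply, hA.2.2.1, eTh_apply_neg]
  have hodd : ∃ c, C 0 0 = 2 * c + 1 := by
    obtain ⟨c, hc⟩ := entry_zero_odd hA
    refine ⟨c - if p = 0 ∧ j = 0 then 1 else 0, ?_⟩
    simp only [hC, Pi.sub_apply, eTh]
    split_ifs <;> omega
  have hn1 : 0 ≤ C p j := by
    have := hA'.1 p j
    rw [h2] at this
    simp only [Pi.add_apply, eTh] at this
    split_ifs at this <;> omega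
  have hn2 : 0 ≤ C (p + 1) j := by
    have := hA.1 (p + 1) j
    rw [h1] at this
    simp only [Pi.add_apply, eTh] at this
    split_ifs at this <;> omega
  have hv1 := vecNorm_add_eTh hn1 hodd (hCsymm _ _) (by omega : -(m : ℤ) ≤ p) hp'.le hj hj'
  have hv2 := vecNorm_add_eTh hn2 hodd (hCsymm _ _) (by omega : -(m : ℤ) ≤ p + 1) (by omega) hj hj'
  have hc1 : cnt p j A = C p j + 1 := by
    simp only [cnt, hC, Pi.sub_apply, eTh, true_and]
    split_ifs <;> omega
  have hc2 : cnt (-p - 1) (-j) (A + rowMove p j) = C (p + 1) j + 1 := by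
    have := hA'.2.2.1 (p + 1) j
    rw [neg_add'] at this
    rw [cnt, this, h2]
    simp only [Pi.add_apply, eTh, true_and]
    split_ifs <;> omega
  have hA1 : A p j = C p j + 1 + if p = 0 ∧ j = 0 then 1 else 0 := by
    rw [← hc1, cnt]; ring
  have hA2 : A (p + 1) j = C (p + 1) j := by
    simp only [hC, Pi.sub_apply, eTh]
    split_ifs <;> omega
  rw [← h1] at hv1
  rw [coef, coef, expo_neg_rowMove hp hj hj' hA.2.2.1, hc1, hc2, h2, hv2, hv1, stepNorm, stepNorm]
  have hq : q ^ (-C (p + 1) j) * q ^ expo n p j A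
      = q ^ (-C p j) * (q ^ (expo n p j A - (rowSum n p A - rowSum n (p + 1) A) + (A p j - A (p + 1) j)
        + (if p = 0 then 1 else 0) - (if p = 0 ∧ j = 0 then 1 else 0)) * q ^ kappa n p A) := by
    rw [← zpow_add₀ q_ne_zero, ← zpow_add₀ q_ne_zero, ← zpow_add₀ q_ne_zero, kappa, hA1, hA2]
    congr 1; ring
  linear_combination (vecNorm m n C * qint (C p j + 1) * qint (C (p + 1) j + 1)) * hq

theorem rowSum_eq_wt {m n d : ℕ} {A : ZMat} (hA : A ∈ XiZ m n d) (r : ℤ) :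
    rowSum n r A = (if r = 0 then 2 else 1) * wt n r A + if r = 0 then 1 else 0 := by
  by_cases hr : r = 0
  · subst hr
    obtain ⟨c, hc⟩ := rowSum_zero_odd hA
    simp only [wt, if_true]
    omega
  · simp only [wt, if_neg hr]; ring

section Adjoint

variable {V : Type*} [AddCommGroup V] [Module K V] {m n d : ℕ} (b : Module.Basis (XiZ m n d) K V)

theorem diag_mul (f g : ZMat → K) : diag b f * diag b g = diag b fun A => f A * g A :=
  ext_vec b fun A _ => by
    rw [Module.End.mul_apply, diag_vec, map_smul, diag_vec, diag_vec, smul_smul, mul_comm]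

theorem diag_congr {f g : ZMat → K} (h : ∀ A ∈ XiZ m n d, f A = g A) : diag b f = diag b g :=
  ext_vec b fun A hA => by rw [diag_vec, diag_vec, h A hA]

theorem diag_const (c : K) : diag b (fun _ => c) = algebraMap K (Module.End K V) c :=
  ext_vec b fun A _ => by rw [diag_vec, Module.algebraMap_end_apply]

theorem diag_pow (f : ZMat → K) (k : ℕ) : diag b f ^ k = diag b fun A => f A ^ k := by
  induction k with
  | zero => simp only [pow_zero, diag_const, map_one]
  | succ k ih => simp only [pow_succ, ih, diag_mul]

theorem torus_mem {S : Subalgebra K (Module.End K V)} {r : ℤ} (h1 : torus b r 1 ∈ S)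
    (h2 : torus b r (-1) ∈ S) (e : ℤ) : torus b r e ∈ S := by
  obtain ⟨k, rfl | rfl⟩ := e.eq_nat_or_neg
  · convert pow_mem h1 k using 1
    rw [torus, torus, diag_pow]
    congr 1; funext A
    rw [← zpow_natCast, ← zpow_mul]
    congr 1; ring
  · convert pow_mem h2 k using 1
    rw [torus, torus, diag_pow]
    congr 1; funext A
    rw [← zpow_natCast, ← zpow_mul]
    congr 1; ring

theorem diag_rowSum_mem {S : Subalgebra K (Module.End K V)} {r s : ℤ}
    (hr : ∀ e, torus b r e ∈ S) (hs : ∀ e, torus b s e ∈ S) (c e f : ℤ) :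
    diag b (fun A => q ^ (c + e * rowSum n r A + f * rowSum n s A)) ∈ S := by
  have h := mul_mem (mul_mem
    (algebraMap_mem S (q ^ (c + e * (if r = 0 then 1 else 0) + f * (if s = 0 then 1 else 0))))
    (hr (e * if r = 0 then 2 else 1))) (hs (f * if s = 0 then 2 else 1))
  convert h using 1
  rw [← diag_const b, torus, torus, diag_mul, diag_mul]
  refine diag_congr b fun A hA => ?_
  rw [← zpow_add₀ q_ne_zero, ← zpow_add₀ q_ne_zero, rowSum_eq_wt hA r, rowSum_eq_wt hA s]
  congr 1; ring

theorem torus_mem_adjoin {r : ℤ} (hr : 0 ≤ r) (hr' : r ≤ m) (e : ℤ) :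
    torus b r e ∈ Algebra.adjoin K (gens b) :=
  torus_mem b (Algebra.subset_adjoin (Or.inr ⟨r, hr, hr', Or.inl rfl⟩))
    (Algebra.subset_adjoin (Or.inr ⟨r, hr, hr', Or.inr rfl⟩)) e

theorem diag_kappa_mem_adjoin {p : ℤ} (hp : 0 ≤ p) (hp' : p < m) (e : ℤ) :
    diag b (fun A => q ^ (e * kappa n p A)) ∈ Algebra.adjoin K (gens b) := by
  convert diag_rowSum_mem b (torus_mem_adjoin b hp hp'.le)
    (torus_mem_adjoin b (by omega : 0 ≤ p + 1) (by omega))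
    (e * (-1 - if p = 0 then 1 else 0)) e (-e) using 3
  rw [kappa]
  congr 1; ring

/-- The symmetric bilinear form for which the given basis is orthogonal with the norms `vecNorm`. -/
def form : LinearMap.BilinForm K V :=
  b.constr K fun A => vecNorm m n A • b.coord A

theorem form_vec (X Y : ZMat) :
    form b (vec b X) (vec b Y) = if X = Y ∧ X ∈ XiZ m n d then vecNorm m n X else 0 := by
  by_cases hX : X ∈ XiZ m n d
  · by_cases hY : Y ∈ XiZ m n d
    · rw [vec_of_mem b hX, vec_of_mem b hY, form, Module.Basis.constr_basis, LinearMap.smul_apply,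
        Module.Basis.coord_apply, Module.Basis.repr_self, Finsupp.single_apply, smul_eq_mul, mul_ite,
        mul_one, mul_zero]
      refine if_congr ?_ rfl rfl
      rw [Subtype.mk.injEq]
      tauto
    · rw [vec, vec, dif_neg hY, map_zero, if_neg]
      rintro ⟨rfl, h⟩; exact hY h
  · rw [vec, dif_neg hX, map_zero, LinearMap.zero_apply, if_neg fun h => hX h.2]

theorem form_apply [Fintype (XiZ m n d)] (v w : V) :
    form b v w = ∑ A : XiZ m n d, vecNorm m n A.1 * (b.repr v A * b.repr w A) := by
  rw [form, Module.Basis.constr_apply_fintype, LinearMap.sum_apply]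
  refine Finset.sum_congr rfl fun A _ => ?_
  simp only [LinearMap.smul_apply, Module.Basis.coord_apply, smul_eq_mul,
    Module.Basis.equivFun_apply]
  ring

theorem form_comm (v w : V) : form b v w = form b w v := by
  have := Fintype.ofFinite (XiZ m n d)
  rw [form_apply, form_apply]
  exact Finset.sum_congr rfl fun A _ => by ring

theorem form_anisotropic (v : V) (h : form b v v = 0) : v = 0 := by
  have := Fintype.ofFinite (XiZ m n d)
  obtain ⟨φ, hφ, -⟩ := exists_realEval
  have h1 := congrArg φ h
  simp only [form_apply, map_sum, map_mul, map_zero] at h1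
  rw [Finset.sum_eq_zero_iff_of_nonneg
    fun A _ => mul_nonneg (realEval_vecNorm_pos hφ m n A.1).le (mul_self_nonneg _)] at h1
  refine b.ext_elem fun A => ?_
  have h2 := h1 A (Finset.mem_univ A)
  have h3 := (realEval_vecNorm_pos hφ m n A.1).ne'
  simpa [h3] using h2

theorem ext_form {f g : Module.End K V}
    (h : ∀ X ∈ XiZ m n d, ∀ Y ∈ XiZ m n d,
      form b (f (vec b X)) (vec b Y) = form b (vec b X) (g (vec b Y))) (v w : V) :
    form b (f v) w = form b v (g w) := by
  have : (form b).comp f LinearMap.id = (form b).comp LinearMap.id g := by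
    refine LinearMap.BilinForm.ext_basis b fun X Y => ?_
    have := h X X.2 Y Y.2
    rwa [vec_of_mem b X.2, vec_of_mem b Y.2] at this
  exact LinearMap.BilinForm.congr_fun this v w

theorem form_diag (f : ZMat → K) (v w : V) : form b (diag b f v) w = form b v (diag b f w) := by
  refine ext_form b (fun X hX Y hY => ?_) v w
  rw [diag_vec, diag_vec, map_smul, map_smul, LinearMap.smul_apply, form_vec, smul_eq_mul,
    smul_eq_mul]
  split_ifs with h
  · rw [h.1]
  · rw [mul_zero, mul_zero]

theorem form_raise {p : ℤ} (hp : 0 ≤ p) (hp' : p < m) (v w : V) : form b (raise b p v) w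
    = form b v ((diag b (fun A => q ^ kappa n p A) * raise b (-p - 1)) w) := by
  refine ext_form b (fun X hX Y hY => ?_) v w
  rw [Module.End.mul_apply, raise_vec b hX, raise_vec b hY, map_sum, map_sum, map_sum,
    LinearMap.sum_apply, ← sum_Icc_comp_neg n fun j => form b (vec b X) _]
  refine Finset.sum_congr rfl fun j hj => ?_
  rw [Finset.mem_Icc] at hj
  rw [map_smul, map_smul, map_smul, diag_vec, map_smul, LinearMap.smul_apply, form_vec, form_vec,
    rowMove_neg, smul_eq_mul, smul_eq_mul, smul_eq_mul]
  by_cases h : X + rowMove p j = Y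
  · subst h
    rw [if_pos ⟨rfl, hY⟩, add_neg_cancel_right, if_pos ⟨rfl, hX⟩, mul_comm,
      vecNorm_mul_coef hX hY hp hp' hj.1 hj.2]
    ring
  · rw [if_neg fun h' => h h'.1, if_neg fun h' => h (by rw [h'.1, neg_add_cancel_right])]
    simp

theorem exists_adjoint_mem (a : Module.End K V) (ha : a ∈ Algebra.adjoin K (gens b)) :
    ∃ a' ∈ Algebra.adjoin K (gens b), ∀ v w, form b (a v) w = form b v (a' w) := by
  induction ha using Algebra.adjoin_induction with
  | mem x hx =>
    rcases hx with ⟨p, hp, hp', rfl⟩ | ⟨s, hs, hs', hx⟩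
    · by_cases h0 : 0 ≤ p
      · refine ⟨_, mul_mem ?_ (raise_mem_adjoin b (by omega) (by omega)), form_raise b h0 hp'⟩
        simpa only [one_mul] using diag_kappa_mem_adjoin b h0 hp' 1
      · obtain ⟨r, rfl⟩ : ∃ r, p = -r - 1 := ⟨-p - 1, by ring⟩
        refine ⟨_, mul_mem (raise_mem_adjoin b (p := r) (by omega) (by omega))
          (diag_kappa_mem_adjoin b (p := r) (by omega) (by omega) (-1)), fun v w => ?_⟩
        have h := form_raise b (p := r) (by omega) (by omega)
          (diag b (fun A => q ^ (-1 * kappa n r A)) w) v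
        rw [Module.End.mul_apply, form_comm, form_comm b v, h, form_diag, ← Module.End.mul_apply,
          ← mul_assoc, diag_mul]
        congr 1
        have : (fun A => q ^ (-1 * kappa n r A) * q ^ kappa n r A) = fun _ => (1 : K) := by
          funext A
          rw [← zpow_add₀ q_ne_zero, neg_one_mul, neg_add_cancel, zpow_zero]
        rw [this, diag_const, map_one, one_mul]
    · rcases hx with rfl | rfl
      · exact ⟨_, torus_mem_adjoin b hs hs' 1, form_diag b _⟩
      · exact ⟨_, torus_mem_adjoin b hs hs' (-1), form_diag b _⟩
  | algebraMap c =>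
    refine ⟨_, algebraMap_mem _ c, fun v w => ?_⟩
    simp [Module.algebraMap_end_apply]
  | add x y _ _ hx hy =>
    obtain ⟨x', hx', h1⟩ := hx
    obtain ⟨y', hy', h2⟩ := hy
    refine ⟨_, add_mem hx' hy', fun v w => ?_⟩
    simp only [LinearMap.add_apply, map_add, h1, h2]
  | mul x y _ _ hx hy =>
    obtain ⟨x', hx', h1⟩ := hx
    obtain ⟨y', hy', h2⟩ := hy
    refine ⟨_, mul_mem hy' hx', fun v w => ?_⟩
    simp only [Module.End.mul_apply, h1, h2]

theorem centralizer_centralizer_adjoin_gens :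
    Subalgebra.centralizer K (Subalgebra.centralizer K
      (Algebra.adjoin K (gens b) : Set (Module.End K V)) : Set (Module.End K V))
      = Algebra.adjoin K (gens b) := by
  have := Module.Finite.of_basis b
  have := isSemisimpleModule_of_adjoint (Algebra.adjoin K (gens b)) (form b) (form_comm b)
    (form_anisotropic b) (exists_adjoint_mem b)
  exact centralizer_centralizer_of_isSemisimpleModule _

end Adjoint

theorem rowSum_eq_zero {m n d : ℕ} {A : ZMat} (hA : A ∈ XiZ m n d) {r : ℤ}
    (hr : ¬(-(m : ℤ) ≤ r ∧ r ≤ m)) : rowSum n r A = 0 :=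
  Finset.sum_eq_zero fun k _ => by
    by_contra h
    exact hr (hA.2.1 r k h).1

theorem rowSum_eq_of_wt_eq {m n d : ℕ} {A D : ZMat} (hA : A ∈ XiZ m n d) (hD : D ∈ XiZ m n d)
    (h : ∀ r : ℤ, 0 ≤ r → r ≤ m → wt n r A = wt n r D) (r : ℤ) :
    rowSum n r A = rowSum n r D := by
  have key (s : ℤ) (hs : 0 ≤ s) : rowSum n s A = rowSum n s D := by
    by_cases hs' : s ≤ m
    · rw [rowSum_eq_wt hA, rowSum_eq_wt hD, h s hs hs']
    · rw [rowSum_eq_zero hA (by omega), rowSum_eq_zero hD (by omega)]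
  rcases le_total 0 r with hr | hr
  · exact key r hr
  · rw [← rowSum_neg hA, ← rowSum_neg hD]
    exact key (-r) (by omega)

/-- The diagonal matrices in `XiZ m n d`. -/
def diagonals (m n d : ℕ) : Finset ZMat :=
  (Set.toFinite (XiZ m n d)).toFinset.filter fun D => ∀ i j, i ≠ j → D i j = 0

theorem mem_diagonals {m n d : ℕ} {D : ZMat} :
    D ∈ diagonals m n d ↔ D ∈ XiZ m n d ∧ ∀ i j, i ≠ j → D i j = 0 := by
  simp [diagonals]

theorem eq_colDiag_of_mem_diagonals {m n d : ℕ} {D : ZMat} (hD : D ∈ diagonals m n d) :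
    D = colDiag m D :=
  eq_colDiag (mem_diagonals.1 hD).1 fun i j h => (mem_diagonals.1 hD).2 i j (by omega)

theorem trZ_mem_diagonals {m n d : ℕ} {D : ZMat} (hD : D ∈ diagonals m n d) :
    trZ D ∈ diagonals n m d := by
  obtain ⟨h1, h2⟩ := mem_diagonals.1 hD
  exact mem_diagonals.2 ⟨trZ_mem_XiZ h1, fun i j h => h2 j i h.symm⟩

theorem eq_of_wt_eq {m n d : ℕ} {D D' : ZMat} (hD : D ∈ diagonals m n d)
    (hD' : D' ∈ diagonals m n d)
    (h : ∀ r : ℤ, 0 ≤ r → r ≤ n → wt m r (trZ D) = wt m r (trZ D')) : D = D' := by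
  rw [eq_colDiag_of_mem_diagonals hD, eq_colDiag_of_mem_diagonals hD']
  funext i j
  rw [colDiag, colDiag, rowSum_eq_of_wt_eq (trZ_mem_XiZ (mem_diagonals.1 hD).1)
    (trZ_mem_XiZ (mem_diagonals.1 hD').1) h]

section Centralizer

variable {V : Type*} [AddCommGroup V] [Module K V] {m n d : ℕ}

theorem exists_weight_projector (b : Module.Basis (XiZ m n d) K V) (D : ZMat) :
    ∃ f : ZMat → K, diag b f ∈ Algebra.adjoin K (gens b) ∧ f D = 1 ∧
      ∀ A ∈ XiZ m n d, f A ≠ 0 → ∀ r : ℤ, 0 ≤ r → r ≤ m → wt n r A = wt n r D := by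
  suffices H : ∀ s : Finset ZMat, ∃ f : ZMat → K, diag b f ∈ Algebra.adjoin K (gens b) ∧ f D = 1 ∧
      ∀ A ∈ s, f A ≠ 0 → ∀ r : ℤ, 0 ≤ r → r ≤ m → wt n r A = wt n r D by
    obtain ⟨f, h1, h2, h3⟩ := H (Set.toFinite (XiZ m n d)).toFinset
    exact ⟨f, h1, h2, fun A hA => h3 A (by simpa using hA)⟩
  intro s
  induction s using Finset.induction_on with
  | empty => exact ⟨fun _ => 1, by rw [diag_const]; exact algebraMap_mem _ _, rfl, by simp⟩
  | insert A s _ ih =>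
    obtain ⟨f, h1, h2, h3⟩ := ih
    by_cases hA : ∀ r : ℤ, 0 ≤ r → r ≤ m → wt n r A = wt n r D
    · refine ⟨f, h1, h2, fun B hB => ?_⟩
      rcases Finset.mem_insert.1 hB with rfl | hB
      · exact fun _ => hA
      · exact h3 B hB
    push Not at hA
    obtain ⟨r, hr, hr', hne⟩ := hA
    have hne' : q ^ wt n r D - q ^ wt n r A ≠ 0 :=
      sub_ne_zero.2 fun h => hne (q_zpow_injective h).symm
    refine ⟨fun B => f B * ((q ^ wt n r D - q ^ wt n r A)⁻¹ * (q ^ wt n r B - q ^ wt n r A)),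
      ?_, ?_, ?_⟩
    · have h4 := mul_mem h1 (Subalgebra.smul_mem _ (sub_mem (torus_mem_adjoin b hr hr' 1)
        (algebraMap_mem _ (q ^ wt n r A))) (q ^ wt n r D - q ^ wt n r A)⁻¹)
      convert h4 using 1
      refine ext_vec b fun B _ => ?_
      simp only [diag_vec, Module.End.mul_apply, LinearMap.smul_apply, LinearMap.sub_apply, torus,
        Module.algebraMap_end_apply, map_smul, one_mul, smul_smul, ← sub_smul]
      congr 1; ring
    · simp only [h2, one_mul]
      exact inv_mul_cancel₀ hne'
    · intro B hB h0
      rcases Finset.mem_insert.1 hB with rfl | hB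
      · simp at h0
      · exact h3 B hB (left_ne_zero_of_mul h0)

variable (b : Module.Basis (XiZ m n d) K V) (b' : Module.Basis (XiZ n m d) K V)

theorem vec_mem_orbit_of_wt_eq (hb : ∀ A, vec b' (trZ A) = vec b A) {A D : ZMat}
    (hA : A ∈ XiZ m n d) (hD : D ∈ diagonals m n d)
    (h : ∀ r : ℤ, 0 ≤ r → r ≤ m → wt n r A = wt n r D) : vec b A ∈ orbit b' (vec b D) := by
  obtain ⟨hD1, hD2⟩ := mem_diagonals.1 hD
  have hsum := rowSum_eq_of_wt_eq hA hD1 h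
  have hcol : colDiag n (trZ A) = trZ D := by
    rw [eq_colDiag_of_mem_diagonals (trZ_mem_diagonals hD)]
    funext i j
    rw [colDiag, colDiag, trZ_trZ, trZ_trZ, hsum]
  rw [← hb A, ← hb D, ← hcol]
  refine vec_mem_orbit b' (trZ_mem_XiZ hA) fun i j hij => ?_
  have hpos : 0 < rowSum n j A :=
    Finset.sum_pos' (fun k _ => hA.1 j k)
      ⟨i, Finset.mem_Icc.2 (hA.2.1 j i hij).2, lt_of_le_of_ne (hA.1 j i) (Ne.symm hij)⟩
  rw [hsum] at hpos
  obtain ⟨k, -, hk⟩ := Finset.exists_ne_zero_of_sum_ne_zero hpos.ne'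
  obtain rfl : j = k := by
    by_contra hjk
    exact hk (hD2 j k hjk)
  exact (hD1.2.1 j j hk).2

theorem commute_adjoin (hb : ∀ A, vec b' (trZ A) = vec b A) {x y : Module.End K V}
    (hx : x ∈ Algebra.adjoin K (gens b)) (hy : y ∈ Algebra.adjoin K (gens b')) : Commute x y :=
  Algebra.commute_of_mem_adjoin_of_forall_mem_commute hy fun y hy =>
    (Algebra.commute_of_mem_adjoin_of_forall_mem_commute hx fun x hx =>
      (commute_gens b b' hb hx hy).symm).symm

theorem apply_vec_mem_orbit (hb : ∀ A, vec b' (trZ A) = vec b A) {φ : Module.End K V}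
    (hφ : φ ∈ Subalgebra.centralizer K (Algebra.adjoin K (gens b) : Set (Module.End K V)))
    {D : ZMat} (hD : D ∈ diagonals m n d) : φ (vec b D) ∈ orbit b' (vec b D) := by
  have := Fintype.ofFinite (XiZ m n d)
  obtain ⟨f, h1, h2, h3⟩ := exists_weight_projector b D
  have h4 : diag b f (φ (vec b D)) = φ (vec b D) := by
    rw [← Module.End.mul_apply, (Subalgebra.mem_centralizer_iff K).1 hφ _ h1, Module.End.mul_apply,
      diag_vec, h2, one_smul]
  rw [← h4, ← b.sum_repr (φ (vec b D)), map_sum]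
  refine Submodule.sum_mem _ fun A _ => ?_
  rw [map_smul, ← vec_of_mem b A.2, diag_vec]
  refine Submodule.smul_mem _ _ ?_
  by_cases hA : f A.1 = 0
  · rw [hA, zero_smul]; exact zero_mem _
  · exact Submodule.smul_mem _ _ (vec_mem_orbit_of_wt_eq b b' hb A.2 hD (h3 A A.2 hA))

theorem centralizer_adjoin_gens (hb : ∀ A, vec b' (trZ A) = vec b A) (hnm : n ≤ m) :
    Subalgebra.centralizer K (Algebra.adjoin K (gens b) : Set (Module.End K V))
      = Algebra.adjoin K (gens b') := by
  refine le_antisymm (fun φ hφ => ?_) fun y hy =>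
    (Subalgebra.mem_centralizer_iff K).2 fun x hx => commute_adjoin b b' hb hx hy
  have hmem (D : ZMat) : ∃ x ∈ Algebra.adjoin K (gens b'),
      D ∈ diagonals m n d → x (vec b D) = φ (vec b D) := by
    by_cases hD : D ∈ diagonals m n d
    · obtain ⟨x, hx, h⟩ := apply_vec_mem_orbit b b' hb hφ hD
      exact ⟨x, hx, fun _ => h⟩
    · exact ⟨0, zero_mem _, fun h => absurd h hD⟩
  choose x hx hxφ using hmem
  choose f hf1 hf2 hf3 using fun D => exists_weight_projector b' (trZ D)
  set r := ∑ D ∈ diagonals m n d, x D * diag b' (f D) with hr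
  have hrmem : r ∈ Algebra.adjoin K (gens b') := sum_mem fun D _ => mul_mem (hx D) (hf1 D)
  have hrD : ∀ D, (∀ i j, i ≠ j → D i j = 0) → φ (vec b D) = r (vec b D) := by
    intro D hD
    by_cases hmem : D ∈ XiZ m n d
    · have hD' := mem_diagonals.2 ⟨hmem, hD⟩
      rw [hr, LinearMap.sum_apply, Finset.sum_eq_single_of_mem D hD']
      · rw [Module.End.mul_apply, ← hb D, diag_vec, hf2, one_smul, hb, hxφ D hD']
      · intro E hE hne
        rw [Module.End.mul_apply, ← hb D, diag_vec]
        have : f E (trZ D) = 0 := by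
          by_contra h0
          exact hne (eq_of_wt_eq hE hD' fun s hs hs' =>
            (hf3 E _ (trZ_mem_XiZ hmem) h0 s hs hs').symm)
        rw [this, zero_smul, map_zero]
    · rw [vec, dif_neg hmem, map_zero, map_zero]
  have : φ = r := by
    refine ext_vec b fun A hA => ?_
    obtain ⟨a, ha, h⟩ := vec_mem_orbit b hA fun i j hij => by
      have := hA.2.1 i j hij; omega
    change a (vec b (colDiag m A)) = vec b A at h
    rw [← h, ← Module.End.mul_apply, ← Module.End.mul_apply,
      ← (Subalgebra.mem_centralizer_iff K).1 hφ _ ha, ← (commute_adjoin b b' hb ha hrmem).eq,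
      Module.End.mul_apply, Module.End.mul_apply, hrD (colDiag m A) fun i j hij => if_neg hij]
  rw [this]; exact hrmem

theorem double_centralizer (hb : ∀ A, vec b' (trZ A) = vec b A) :
    Subalgebra.centralizer K (Algebra.adjoin K (gens b) : Set (Module.End K V))
      = Algebra.adjoin K (gens b') ∧
    Subalgebra.centralizer K (Algebra.adjoin K (gens b') : Set (Module.End K V))
      = Algebra.adjoin K (gens b) := by
  have hb' : ∀ A, vec b (trZ A) = vec b' A := fun A => by rw [← hb, trZ_trZ]
  rcases le_total n m with h | h
  · have h1 := centralizer_adjoin_gens b b' hb h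
    exact ⟨h1, by rw [← h1, centralizer_centralizer_adjoin_gens]⟩
  · have h1 := centralizer_adjoin_gens b' b hb' h
    exact ⟨by rw [← h1, centralizer_centralizer_adjoin_gens], h1⟩

end Centralizer

theorem II_odd (n : ℕ) : II (2 * n + 1) = (Finset.Icc (-(n : ℤ)) n).map ⟨_, Int.cast_injective⟩ := by
  ext x
  simp only [II, Finset.mem_image, Finset.mem_range, Finset.mem_map, Finset.mem_Icc,
    Function.Embedding.coeFn_mk]
  constructor
  · rintro ⟨k, hk, rfl⟩
    exact ⟨k - n, by omega, by push_cast; ring⟩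
  · rintro ⟨k, hk, rfl⟩
    refine ⟨(k + n).toNat, by omega, ?_⟩
    have : (((k + n).toNat : ℤ) : ℚ) = k + n := by rw [Int.toNat_of_nonneg (by omega)]; push_cast; rfl
    rw [← Int.cast_natCast (R := ℚ), this]; push_cast; ring

theorem mem_II_odd {n : ℕ} {x : ℚ} : x ∈ II (2 * n + 1) ↔ ∃ k : ℤ, (-(n : ℤ) ≤ k ∧ k ≤ n) ∧ (k : ℚ) = x := by
  simp [II_odd]

theorem cast_mem_II_odd {n : ℕ} {k : ℤ} : (k : ℚ) ∈ II (2 * n + 1) ↔ -(n : ℤ) ≤ k ∧ k ≤ n := by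
  simp [II_odd]

theorem mem_II_even {m : ℕ} {i : ℚ} :
    i ∈ II (2 * m) ∧ 0 < i ↔ ∃ p : ℤ, 0 ≤ p ∧ p < m ∧ i = p + 1 / 2 := by
  simp only [II, Finset.mem_image, Finset.mem_range]
  constructor
  · rintro ⟨⟨k, hk, rfl⟩, h0⟩
    refine ⟨k - m, ?_, by omega, by push_cast; ring⟩
    have h1 : (2 * m : ℚ) < 2 * k + 1 := by push_cast at h0; linarith
    have h2 : (2 * m : ℤ) < 2 * k + 1 := by exact_mod_cast h1
    omega
  · rintro ⟨p, hp, hp', rfl⟩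
    lift p to ℕ using hp
    refine ⟨⟨p + m, by omega, by push_cast; ring⟩, by positivity⟩

theorem mem_II_odd_pos {m : ℕ} {i : ℚ} :
    i ∈ II (2 * m + 1) ∧ 0 < i ↔ ∃ r : ℤ, 0 < r ∧ r ≤ m ∧ i = r := by
  rw [mem_II_odd]
  constructor
  · rintro ⟨⟨k, hk, rfl⟩, h0⟩
    exact ⟨k, by exact_mod_cast h0, hk.2, rfl⟩
  · rintro ⟨p, hp, hp', rfl⟩
    exact ⟨⟨p, by omega, rfl⟩, by exact_mod_cast hp⟩

theorem sum_filter_II {M : Type*} [AddCommMonoid M] (n : ℕ) (P : ℚ → Prop) [DecidablePred P]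
    (f : ℚ → M) :
    ∑ j ∈ (II (2 * n + 1)).filter P, f j
      = ∑ j ∈ (Finset.Icc (-(n : ℤ)) n).filter (fun k : ℤ => P k), f (j : ℤ) := by
  rw [Finset.sum_filter, Finset.sum_filter, II_odd, Finset.sum_map]
  rfl

theorem sum_II {M : Type*} [AddCommMonoid M] (n : ℕ) (f : ℚ → M) :
    ∑ j ∈ II (2 * n + 1), f j = ∑ j ∈ Finset.Icc (-(n : ℤ)) n, f (j : ℤ) := by
  rw [II_odd, Finset.sum_map]
  rfl

/-- The restriction of a matrix to integer labels. -/
def restrZ (A : Mat) : ZMat := fun i j => A i j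

/-- A matrix all of whose nonzero entries carry integer labels. -/
def IntSupp (A : Mat) : Prop := ∀ x y, A x y ≠ 0 → ∃ i j : ℤ, (i : ℚ) = x ∧ (j : ℚ) = y

theorem intSupp_of_mem {m n d : ℕ} {A : Mat} (hA : A ∈ Xij m n d) : IntSupp A := by
  intro x y h
  obtain ⟨hx, hy⟩ := hA.1 x y h
  obtain ⟨i, -, hi⟩ := mem_II_odd.1 hx
  obtain ⟨j, -, hj⟩ := mem_II_odd.1 hy
  exact ⟨i, j, hi, hj⟩

theorem restrZ_mem_XiZ_iff {m n d : ℕ} {A : Mat} (hA : IntSupp A) :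
    restrZ A ∈ XiZ m n d ↔ A ∈ Xij m n d := by
  have hsum : ∑ i ∈ Finset.Icc (-(m : ℤ)) m, ∑ j ∈ Finset.Icc (-(n : ℤ)) n, restrZ A i j = 2 * d + 1
      ↔ ∑ i ∈ II (2 * m + 1), ∑ j ∈ II (2 * n + 1), A i j = 2 * d + 1 := by
    simp only [sum_II, restrZ]
    norm_cast
  constructor
  · rintro ⟨-, h2, h3, h4⟩
    refine ⟨fun x y h => ?_, fun x y => ?_, hsum.1 h4⟩
    · obtain ⟨i, j, rfl, rfl⟩ := hA x y h
      rw [cast_mem_II_odd, cast_mem_II_odd]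
      exact h2 i j (by simpa [restrZ] using h)
    · by_cases h : A x y = 0
      · by_contra h'
        obtain ⟨i, j, hi, hj⟩ := hA (-x) (-y) (by omega)
        have := h3 i j
        simp only [restrZ, Int.cast_neg, hi, hj, neg_neg] at this
        omega
      · obtain ⟨i, j, rfl, rfl⟩ := hA x y h
        have := h3 i j
        simp only [restrZ, Int.cast_neg] at this
        omega
  · rintro ⟨h2, h3, h4⟩
    refine ⟨fun i j => Int.natCast_nonneg _, fun i j h => ?_, fun i j => ?_, hsum.2 h4⟩
    · rw [← cast_mem_II_odd, ← cast_mem_II_odd]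
      exact h2 i j (by simpa [restrZ] using h)
    · simp only [restrZ, Int.cast_neg, ← h3]

/-- The extension by zero of an integer matrix. -/
def ofZ (B : ZMat) : Mat := fun x y => if x.den = 1 ∧ y.den = 1 then (B x.num y.num).toNat else 0

theorem intSupp_ofZ (B : ZMat) : IntSupp (ofZ B) := by
  intro x y h
  rw [ofZ, ne_eq, ite_eq_right_iff, Classical.not_imp] at h
  exact ⟨x.num, y.num, Rat.coe_int_num_of_den_eq_one h.1.1, Rat.coe_int_num_of_den_eq_one h.1.2⟩

theorem restrZ_ofZ {B : ZMat} (h : ∀ i j, 0 ≤ B i j) : restrZ (ofZ B) = B := by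
  funext i j
  simp [restrZ, ofZ, h]

theorem restrZ_inj {A B : Mat} (hA : IntSupp A) (hB : IntSupp B) (h : restrZ A = restrZ B) : A = B := by
  have key (i j : ℤ) : A i j = B i j := by
    have := congrFun (congrFun h i) j
    simpa [restrZ] using this
  funext x y
  by_cases h1 : A x y = 0
  · by_cases h2 : B x y = 0
    · rw [h1, h2]
    · obtain ⟨i, j, rfl, rfl⟩ := hB x y h2
      exact key i j
  · obtain ⟨i, j, rfl, rfl⟩ := hA x y h1
    exact key i j

/-- Matrices with integer labels are determined by their restrictions to integer labels. -/
def XijEquiv (m n d : ℕ) : {A : Mat // A ∈ Xij m n d} ≃ XiZ m n d where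
  toFun A := ⟨restrZ A, (restrZ_mem_XiZ_iff (intSupp_of_mem A.2)).2 A.2⟩
  invFun B := ⟨ofZ B, (restrZ_mem_XiZ_iff (intSupp_ofZ B)).1 (by rw [restrZ_ofZ B.2.1]; exact B.2)⟩
  left_inv A := Subtype.ext (restrZ_inj (intSupp_ofZ _) (intSupp_of_mem A.2)
    (restrZ_ofZ fun i j => Int.natCast_nonneg _))
  right_inv B := Subtype.ext (restrZ_ofZ B.2.1)

/-- The standard basis of `FM (Xij m n d)`, with integer labels. -/
def leftBasis (m n d : ℕ) : Module.Basis (XiZ m n d) K (FM (Xij m n d)) :=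
  Finsupp.basisSingleOne.reindex (XijEquiv m n d)

/-- Transposition as an equivalence. -/
def trEquiv (m n d : ℕ) : XiZ m n d ≃ XiZ n m d where
  toFun A := ⟨trZ A, trZ_mem_XiZ A.2⟩
  invFun A := ⟨trZ A, trZ_mem_XiZ A.2⟩
  left_inv _ := rfl
  right_inv _ := rfl

/-- The standard basis of `FM (Xij m n d)`, labelled by transposed matrices. -/
def rightBasis (m n d : ℕ) : Module.Basis (XiZ n m d) K (FM (Xij m n d)) :=
  (leftBasis m n d).reindex (trEquiv m n d)

theorem vec_rightBasis (m n d : ℕ) (A : ZMat) :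
    vec (rightBasis m n d) (trZ A) = vec (leftBasis m n d) A := by
  by_cases hA : A ∈ XiZ m n d
  · rw [vec_of_mem _ hA, vec_of_mem _ (trZ_mem_XiZ hA), rightBasis, Module.Basis.reindex_apply]
    rfl
  · rw [vec, vec, dif_neg hA, dif_neg fun h : trZ A ∈ _ => hA (trZ_mem_XiZ h)]

theorem tP_eq_vec {m n d : ℕ} {A : Mat} (hA : IntSupp A) :
    tP (Xij m n d) A = vec (leftBasis m n d) (restrZ A) := by
  by_cases h : A ∈ Xij m n d
  · rw [tP, dif_pos h, vec_of_mem _ ((restrZ_mem_XiZ_iff hA).2 h), leftBasis,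
      Module.Basis.reindex_apply, Finsupp.coe_basisSingleOne]
    congr 1
    rw [Equiv.eq_symm_apply]
    rfl
  · rw [tP, dif_neg h, vec, dif_neg fun h' => h ((restrZ_mem_XiZ_iff hA).1 h')]

theorem opOf_apply_vec {m n d : ℕ} (f : Mat → FM (Xij m n d)) {A : Mat} (hA : A ∈ Xij m n d) :
    opOf f (vec (leftBasis m n d) (restrZ A)) = f A := by
  rw [← tP_eq_vec (intSupp_of_mem hA), tP, dif_pos hA, opOf, Finsupp.lift_apply,
    Finsupp.sum_single_index] <;> simp

theorem ext_restrZ {m n d : ℕ} {f g : Module.End K (FM (Xij m n d))}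
    (h : ∀ A ∈ Xij m n d, f (vec (leftBasis m n d) (restrZ A)) = g (vec (leftBasis m n d) (restrZ A))) :
    f = g := by
  refine ext_vec (leftBasis m n d) fun B hB => ?_
  have := h _ ((XijEquiv m n d).symm ⟨B, hB⟩).2
  rwa [show restrZ ((XijEquiv m n d).symm ⟨B, hB⟩).1 = B from restrZ_ofZ hB.1] at this

theorem chiM_cast (r c i j : ℤ) : (chiM r c i j : ℤ) = eTh r c i j := by
  simp only [chiM, eTh]
  push_cast
  norm_cast

theorem chiM_eq_zero {r c : ℤ} {x y : ℚ} (h : ¬∃ i j : ℤ, (i : ℚ) = x ∧ (j : ℚ) = y) :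
    chiM r c x y = 0 := by
  rw [chiM, if_neg, if_neg]
  · rintro ⟨rfl, rfl⟩; exact h ⟨-r, -c, by push_cast; rfl, by push_cast; rfl⟩
  · rintro ⟨rfl, rfl⟩; exact h ⟨r, c, rfl, rfl⟩

theorem tP_matMove {m n d : ℕ} {A : Mat} (hA : A ∈ Xij m n d) {B : ZMat} {x y z w : ℤ}
    (hB : B = restrZ A + (eTh x y - eTh z w))
    (hc : (A z w : ℤ) - (if z = 0 ∧ w = 0 then 1 else 0) ≠ 0) :
    tP (Xij m n d) (matMove A x y z w) = vec (leftBasis m n d) B := by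
  have hI : IntSupp (matMove A x y z w) := by
    intro s t hst
    by_contra h
    have h1 : A s t = 0 := by
      by_contra h0
      exact h (intSupp_of_mem hA s t h0)
    rw [matMove, h1, chiM_eq_zero h, chiM_eq_zero h] at hst
    exact hst rfl
  rw [tP_eq_vec hI, hB]
  congr 1
  funext s t
  have hZ := (restrZ_mem_XiZ_iff (intSupp_of_mem hA)).2 hA
  have hle : eTh z w s t ≤ restrZ A s t := by
    obtain ⟨c, hodd⟩ := entry_zero_odd hZ
    have h0 := hZ.1 s t
    have hs := hZ.2.2.1 z w
    have h0' := hZ.1 z w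
    change restrZ A z w - _ ≠ 0 at hc
    simp only [eTh]
    by_cases h1 : s = z ∧ t = w
    · obtain ⟨rfl, rfl⟩ := h1
      by_cases h2 : s = 0 ∧ t = 0
      · obtain ⟨rfl, rfl⟩ := h2
        simp at hc ⊢; omega
      · rw [if_neg h2] at hc
        rw [if_neg (by omega : ¬(s = -s ∧ t = -t))]; simp; omega
    · rw [if_neg h1]
      by_cases h2 : s = -z ∧ t = -w
      · obtain ⟨rfl, rfl⟩ := h2
        have : ¬ (z = 0 ∧ w = 0) := by omega
        rw [if_neg this] at hc
        simp; omega
      · rw [if_neg h2]; simpa using h0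
  rw [Pi.add_apply, Pi.add_apply, Pi.sub_apply, Pi.sub_apply, ← chiM_cast, ← chiM_cast] at *
  simp only [restrZ, matMove] at *
  have := chiM_cast z w s t
  omega

theorem add_half_add_half (p : ℤ) : (p : ℚ) + 1 / 2 + 1 / 2 = ((p + 1 : ℤ) : ℚ) := by
  push_cast; ring

theorem add_half_sub_half (p : ℤ) : (p : ℚ) + 1 / 2 - 1 / 2 = (p : ℚ) := by ring

theorem add_half_eq_half (p : ℤ) : (p : ℚ) + 1 / 2 = 1 / 2 ↔ p = 0 := by
  rw [add_eq_right, Int.cast_eq_zero]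

theorem filter_Icc_lt {n : ℕ} {j : ℤ} (hj' : j ≤ n) :
    (Finset.Icc (-(n : ℤ)) n).filter (fun k => k < j) = Finset.Ico (-(n : ℤ)) j := by
  ext k; simp only [Finset.mem_filter, Finset.mem_Icc, Finset.mem_Ico]; omega

theorem sum_filter_gt {n : ℕ} {j : ℤ} (hj : -(n : ℤ) ≤ j) (f : ℤ → ℤ) :
    ∑ k ∈ (Finset.Icc (-(n : ℤ)) n).filter (fun k => j < k), f k
      = ∑ k ∈ Finset.Ico (-(n : ℤ)) (-j), f (-k) := by
  refine Finset.sum_nbij' (fun k => -k) (fun k => -k) ?_ ?_ ?_ ?_ ?_ <;>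
    simp only [Finset.mem_filter, Finset.mem_Icc, Finset.mem_Ico, neg_neg, implies_true]
  all_goals intro k hk; omega

theorem sum_filter_le_nonpos_add_pos {V : Type*} [AddCommMonoid V] (s : Finset ℤ) (f : ℤ → V) :
    ∑ j ∈ s.filter (fun j => j ≤ 0), f j + ∑ j ∈ s.filter (fun j => 0 < j), f j = ∑ j ∈ s, f j := by
  rw [← Finset.sum_filter_add_sum_filter_not s (fun j => j ≤ 0)]
  simp only [not_le]

theorem smul_tP_matMove {m n d : ℕ} {A : Mat} (hA : A ∈ Xij m n d) {B : ZMat} {x y z w : ℤ}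
    (hB : B = restrZ A + (eTh x y - eTh z w)) (c : K) (P : Prop) [Decidable P]
    (hP : P ↔ z = 0 ∧ w = 0) :
    (c * qint (A z w - if P then 1 else 0)) • tP (Xij m n d) (matMove A x y z w)
      = (c * qint (A z w - if P then 1 else 0)) • vec (leftBasis m n d) B := by
  by_cases h : (A z w : ℤ) - (if P then 1 else 0) = 0
  · rw [h, qint_zero, mul_zero, zero_smul, zero_smul]
  · rw [tP_matMove hA hB]
    rwa [if_congr hP rfl rfl] at h

theorem ite_smul_tP_matMove {m n d : ℕ} {A : Mat} (hA : A ∈ Xij m n d) {B : ZMat} {x y z w : ℤ}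
    (hB : B = restrZ A + (eTh x y - eTh z w)) (c : K) (P : Prop) [Decidable P]
    (hP : P ↔ z = 0 ∧ w = 0) :
    (if (if P then 1 else 0) < A z w then
        (c * qint (A z w - if P then 1 else 0)) • tP (Xij m n d) (matMove A x y z w)
      else 0) = (c * qint (A z w - if P then 1 else 0)) • vec (leftBasis m n d) B := by
  have hodd : P → 1 ≤ A z w := fun h => by
    obtain ⟨rfl, rfl⟩ := hP.1 h
    obtain ⟨c, hc⟩ := entry_zero_odd ((restrZ_mem_XiZ_iff (intSupp_of_mem hA)).2 hA)
    simp only [restrZ] at hc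
    omega
  rw [smul_tP_matMove hA hB c P hP]
  split_ifs with h1 h2 h2
  · rfl
  · have := hodd h1
    rw [show (A z w : ℤ) - 1 = 0 by omega, qint_zero, mul_zero, zero_smul]
  · rfl
  · rw [show (A z w : ℤ) - 0 = 0 by omega, qint_zero, mul_zero, zero_smul]

theorem BRjn_eq {m n d : ℕ} (r : ℤ) :
    BRjn m (Xij m n d) (r + 1 / 2) = raise (rightBasis m n d) r := by
  refine ext_restrZ fun A hA => ?_
  have hZ := (restrZ_mem_XiZ_iff (intSupp_of_mem hA)).2 hA
  rw [BRjn, opOf_apply_vec _ hA, raise_tr_vec (leftBasis m n d) _ (vec_rightBasis m n d) hZ,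
    ← sum_filter_le_nonpos_add_pos]
  simp only [add_half_add_half, add_half_sub_half, add_half_eq_half, sum_filter_II,
    Int.cast_nonpos, Int.cast_pos, Int.cast_eq_zero, Int.cast_lt]
  congr 1
  · refine Finset.sum_congr rfl fun j hj => ?_
    rw [Finset.mem_filter, Finset.mem_Icc] at hj
    rw [filter_Icc_lt hj.1.2, ite_smul_tP_matMove hA (congrArg _ (trZ_rowMove r j)) _ _ and_comm,
      coef, expo, cnt, if_neg (by omega : ¬(r = 0 ∧ 0 < j)), sub_zero]
    rfl
  · refine Finset.sum_congr rfl fun j hj => ?_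
    rw [Finset.mem_filter, Finset.mem_Icc] at hj
    have hj0 : ¬(r = 0 ∧ j = 0) := by omega
    have := smul_tP_matMove hA (congrArg _ (trZ_rowMove r j)) (q ^ (∑ k ∈ Finset.Ico (-(m : ℤ)) j,
      ((A k r : ℤ) - A k (r + 1 : ℤ)) - if r = 0 then 1 else 0)) _ and_comm
    rw [if_neg hj0, sub_zero] at this
    rw [filter_Icc_lt hj.1.2, this, coef, expo, cnt, if_neg hj0, sub_zero,
      if_congr (and_iff_left hj.2) rfl rfl]
    rfl

theorem rightMove_eq (r j : ℤ) : trZ (rowMove (-r - 1) (-j)) = eTh j r - eTh j (r + 1) := by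
  rw [rowMove_neg, ← neg_sub, ← trZ_rowMove]; rfl

theorem leftMove_eq (p j : ℤ) : rowMove (-p - 1) (-j) = eTh p j - eTh (p + 1) j := by
  rw [rowMove_neg, rowMove, neg_sub]

theorem BRj_eq {m n d : ℕ} {r : ℤ} (hr : 0 ≤ r) :
    BRj m (Xij m n d) (r + 1 / 2) = raise (rightBasis m n d) (-r - 1) := by
  refine ext_restrZ fun A hA => ?_
  have hZ := (restrZ_mem_XiZ_iff (intSupp_of_mem hA)).2 hA
  rw [BRj, opOf_apply_vec _ hA, raise_tr_vec (leftBasis m n d) _ (vec_rightBasis m n d) hZ,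
    ← sum_Icc_comp_neg]
  simp only [add_half_add_half, add_half_sub_half, sum_filter_II, sum_II, Int.cast_lt]
  refine Finset.sum_congr rfl fun j hj => ?_
  rw [Finset.mem_Icc] at hj
  have h0 : ¬(j = 0 ∧ r + 1 = 0) := by omega
  have := smul_tP_matMove hA (congrArg _ (rightMove_eq r j)) (q ^ (∑ k ∈ Finset.Icc (-(m : ℤ)) m
    with j < k, ((A k (r + 1 : ℤ) : ℤ) - A k r))) _ Iff.rfl
  rw [if_neg h0, sub_zero] at this
  rw [this, sum_filter_gt hj.1 fun k => (A k (r + 1 : ℤ) : ℤ) - A k r, coef, expo, cnt,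
    if_neg (by omega : ¬(-r - 1 = 0 ∧ 0 < -j)), if_neg (by omega : ¬(-r - 1 = 0 ∧ -j = 0)),
    sub_zero, sub_zero, sub_add_cancel, ← neg_add']
  have hneg (k s : ℤ) : trZ (restrZ A) (-s) k = A (-k : ℤ) s := by
    rw [← neg_neg k]
    exact (hZ.2.2.1 (-k) s).trans (by rw [neg_neg]; rfl)
  simp only [hneg, neg_neg]

theorem BLj_eq {m n d : ℕ} (p : ℤ) :
    BLj n (Xij m n d) (p + 1 / 2) = raise (leftBasis m n d) p * diag (leftBasis m n d)
      fun A => q ^ ((1 + if p = 0 then 1 else 0) + 1 * rowSum n (p + 1) A + (-1) * rowSum n p A) := by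
  refine ext_restrZ fun A hA => ?_
  have hZ := (restrZ_mem_XiZ_iff (intSupp_of_mem hA)).2 hA
  have hsum (j : ℤ) (hj : j ∈ Finset.Icc (-(n : ℤ)) n) :
      ∑ k ∈ (Finset.Icc (-(n : ℤ)) n).filter (fun k => j ≤ k), ((A (p + 1 : ℤ) k : ℤ) - A p k)
        = rowSum n (p + 1) (restrZ A) - rowSum n p (restrZ A)
          + ∑ k ∈ Finset.Ico (-(n : ℤ)) j, ((A p k : ℤ) - A (p + 1 : ℤ) k) := by
    have h1 : rowSum n (p + 1) (restrZ A) - rowSum n p (restrZ A)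
        = ∑ k ∈ Finset.Icc (-(n : ℤ)) n, ((A (p + 1 : ℤ) k : ℤ) - A p k) :=
      (Finset.sum_sub_distrib _ _).symm
    rw [h1, ← Finset.sum_filter_add_sum_filter_not (Finset.Icc (-(n : ℤ)) n) (fun k => j ≤ k),
      add_assoc, left_eq_add]
    simp only [not_le]
    rw [filter_Icc_lt (Finset.mem_Icc.1 hj).2, ← Finset.sum_add_distrib]
    exact Finset.sum_eq_zero fun k _ => by ring
  rw [BLj, opOf_apply_vec _ hA, Module.End.mul_apply, diag_vec, map_smul, raise_vec _ hZ,
    Finset.smul_sum, ← sum_filter_le_nonpos_add_pos]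
  simp only [add_half_add_half, add_half_sub_half, add_half_eq_half, sum_filter_II,
    Int.cast_nonpos, Int.cast_pos, Int.cast_eq_zero, Int.cast_le]
  congr 1
  · refine Finset.sum_congr rfl fun j hj => ?_
    rw [Finset.mem_filter] at hj
    rw [ite_smul_tP_matMove hA rfl _ _ Iff.rfl, hsum j hj.1,
      coef, expo, cnt, if_neg (by omega : ¬(p = 0 ∧ 0 < j)), sub_zero, smul_smul, ← mul_assoc,
      ← zpow_add₀ q_ne_zero]
    simp only [restrZ, rowMove]
    congr 3; ring
  · refine Finset.sum_congr rfl fun j hj => ?_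
    rw [Finset.mem_filter] at hj
    have hj0 : ¬(p = 0 ∧ j = 0) := by omega
    have := smul_tP_matMove hA rfl (q ^ (∑ k ∈ (Finset.Icc (-(n : ℤ)) n).filter (fun k => j ≤ k),
      ((A (p + 1 : ℤ) k : ℤ) - A p k) + 1)) (x := p + 1) (y := j) (z := p) (w := j) _ Iff.rfl
    rw [if_neg hj0, sub_zero] at this
    rw [this, hsum j hj.1, coef, expo, cnt, if_neg hj0, sub_zero,
      if_congr (and_iff_left hj.2) rfl rfl, smul_smul, ← mul_assoc, ← zpow_add₀ q_ne_zero]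
    simp only [restrZ, rowMove]
    congr 3; ring

theorem BLjn_eq {m n d : ℕ} {p : ℤ} (hp : 0 ≤ p) :
    BLjn n (Xij m n d) (p + 1 / 2) = raise (leftBasis m n d) (-p - 1) * diag (leftBasis m n d)
      fun A => q ^ (1 + 1 * rowSum n p A + (-1) * rowSum n (p + 1) A) := by
  refine ext_restrZ fun A hA => ?_
  have hZ := (restrZ_mem_XiZ_iff (intSupp_of_mem hA)).2 hA
  have hsum (j : ℤ) (hj : j ∈ Finset.Icc (-(n : ℤ)) n) :
      ∑ k ∈ (Finset.Icc (-(n : ℤ)) n).filter (fun k => k ≤ j), ((A p k : ℤ) - A (p + 1 : ℤ) k)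
        = rowSum n p (restrZ A) - rowSum n (p + 1) (restrZ A)
          + ∑ k ∈ Finset.Ico (-(n : ℤ)) (-j), ((A (p + 1 : ℤ) (-k : ℤ) : ℤ) - A p (-k : ℤ)) := by
    have h1 : rowSum n p (restrZ A) - rowSum n (p + 1) (restrZ A)
        = ∑ k ∈ Finset.Icc (-(n : ℤ)) n, ((A p k : ℤ) - A (p + 1 : ℤ) k) :=
      (Finset.sum_sub_distrib _ _).symm
    rw [h1, ← Finset.sum_filter_add_sum_filter_not (Finset.Icc (-(n : ℤ)) n) (fun k => k ≤ j),
      add_assoc, left_eq_add]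
    simp only [not_le]
    rw [← sum_filter_gt (Finset.mem_Icc.1 hj).1 fun k => (A (p + 1 : ℤ) k : ℤ) - A p k,
      ← Finset.sum_add_distrib]
    exact Finset.sum_eq_zero fun k _ => by ring
  rw [BLjn, opOf_apply_vec _ hA, Module.End.mul_apply, diag_vec, map_smul, raise_vec _ hZ,
    Finset.smul_sum, ← sum_Icc_comp_neg]
  simp only [add_half_add_half, add_half_sub_half, sum_filter_II, sum_II, Int.cast_le]
  refine Finset.sum_congr rfl fun j hj => ?_
  have h0 : ¬(p + 1 = 0 ∧ j = 0) := by omega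
  have := smul_tP_matMove hA (congrArg _ (leftMove_eq p j)) (q ^ (∑ k ∈ Finset.Icc (-(n : ℤ)) n
    with k ≤ j, ((A p k : ℤ) - A (p + 1 : ℤ) k) + 1)) _ Iff.rfl
  rw [if_neg h0, sub_zero] at this
  have hneg (k s : ℤ) : restrZ A (-s) k = A s (-k : ℤ) := by
    rw [← neg_neg k]
    exact (hZ.2.2.1 s (-k)).trans (by rw [neg_neg]; rfl)
  rw [this, hsum j hj, coef, expo, cnt,
    if_neg (by omega : ¬(-p - 1 = 0 ∧ 0 < -j)), if_neg (by omega : ¬(-p - 1 = 0 ∧ -j = 0)),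
    sub_zero, sub_zero, sub_add_cancel, ← neg_add', smul_smul, ← mul_assoc, ← zpow_add₀ q_ne_zero]
  simp only [hneg, neg_neg]
  congr 3; ring

theorem dLj_eq {m n d : ℕ} {r : ℤ} (hr : r ≠ 0) (e : ℤ) :
    dLj n (Xij m n d) r e = torus (leftBasis m n d) r e := by
  refine ext_restrZ fun A hA => ?_
  rw [dLj, opOf_apply_vec _ hA, torus, diag_vec, tP_eq_vec (intSupp_of_mem hA), wt, if_neg hr,
    sum_II]
  rfl

theorem dL0j_eq {m n d : ℕ} (e : ℤ) :
    dL0j n (Xij m n d) e = torus (leftBasis m n d) 0 e := by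
  refine ext_restrZ fun A hA => ?_
  rw [dL0j, opOf_apply_vec _ hA, torus, diag_vec, tP_eq_vec (intSupp_of_mem hA), wt, if_pos rfl,
    sum_II, rowSum]
  simp only [restrZ, Int.cast_zero]

theorem dRj_eq {m n d : ℕ} {r : ℤ} (hr : r ≠ 0) (e : ℤ) :
    dRj m (Xij m n d) r e = torus (rightBasis m n d) r e := by
  refine ext_restrZ fun A hA => ?_
  rw [dRj, opOf_apply_vec _ hA, torus, ← vec_rightBasis, diag_vec, vec_rightBasis,
    tP_eq_vec (intSupp_of_mem hA), wt, if_neg hr, sum_II]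
  rfl

theorem dR0j_eq {m n d : ℕ} (e : ℤ) :
    dR0j m (Xij m n d) e = torus (rightBasis m n d) 0 e := by
  refine ext_restrZ fun A hA => ?_
  rw [dR0j, opOf_apply_vec _ hA, torus, ← vec_rightBasis, diag_vec, vec_rightBasis,
    tP_eq_vec (intSupp_of_mem hA), wt, if_pos rfl, sum_II, rowSum]
  simp only [restrZ, trZ, Int.cast_zero]

theorem gensRj_eq (m n d : ℕ) : gensRj m n d = gens (rightBasis m n d) := by
  ext O
  constructor
  · rintro (⟨i, hi, hi0, h⟩ | rfl | rfl | ⟨i, hi, hi0, h⟩)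
    · obtain ⟨r, hr, hr', rfl⟩ := mem_II_even.1 ⟨hi, hi0⟩
      rcases h with rfl | rfl
      · exact Or.inl ⟨-r - 1, by omega, by omega, BRj_eq hr⟩
      · exact Or.inl ⟨r, by omega, by omega, BRjn_eq r⟩
    · exact Or.inr ⟨0, le_rfl, by omega, Or.inl (dR0j_eq 1)⟩
    · exact Or.inr ⟨0, le_rfl, by omega, Or.inr (dR0j_eq (-1))⟩
    · obtain ⟨r, hr, hr', rfl⟩ := mem_II_odd_pos.1 ⟨hi, hi0⟩
      rcases h with rfl | rfl
      · exact Or.inr ⟨r, hr.le, hr', Or.inl (dRj_eq hr.ne' 1)⟩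
      · exact Or.inr ⟨r, hr.le, hr', Or.inr (dRj_eq hr.ne' (-1))⟩
  · rintro (⟨r, hr, hr', rfl⟩ | ⟨r, hr, hr', h⟩)
    · by_cases h0 : 0 ≤ r
      · obtain ⟨h1, h2⟩ := mem_II_even.2 ⟨r, h0, hr', rfl⟩
        exact Or.inl ⟨_, h1, h2, Or.inr (BRjn_eq r).symm⟩
      · obtain ⟨s, rfl⟩ : ∃ s, r = -s - 1 := ⟨-r - 1, by ring⟩
        obtain ⟨h1, h2⟩ := mem_II_even (m := n).2 ⟨s, by omega, by omega, rfl⟩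
        exact Or.inl ⟨_, h1, h2, Or.inl (BRj_eq (by omega)).symm⟩
    · rcases hr.eq_or_lt with rfl | hr0
      · rcases h with rfl | rfl
        · exact Or.inr (Or.inl (dR0j_eq 1).symm)
        · exact Or.inr (Or.inr (Or.inl (dR0j_eq (-1)).symm))
      · obtain ⟨h1, h2⟩ := mem_II_odd_pos.2 ⟨r, hr0, hr', rfl⟩
        refine Or.inr (Or.inr (Or.inr ⟨_, h1, h2, ?_⟩))
        rwa [dRj_eq hr0.ne', dRj_eq hr0.ne']

theorem mem_of_mul_diag_mem {V : Type*} [AddCommGroup V] [Module K V] {m n d : ℕ}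
    (b : Module.Basis (XiZ m n d) K V) {S : Subalgebra K (Module.End K V)} {x : Module.End K V}
    {r s : ℤ} (hr : ∀ e, torus b r e ∈ S) (hs : ∀ e, torus b s e ∈ S) (c e f : ℤ)
    (hx : x * diag b (fun A => q ^ (c + e * rowSum n r A + f * rowSum n s A)) ∈ S) : x ∈ S := by
  have h := mul_mem hx (diag_rowSum_mem b hr hs (-c) (-e) (-f))
  rw [mul_assoc, diag_mul] at h
  have h1 : (fun A : ZMat => q ^ (c + e * rowSum n r A + f * rowSum n s A)
      * q ^ (-c + -e * rowSum n r A + -f * rowSum n s A)) = fun _ => (1 : K) := by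
    funext A
    rw [← zpow_add₀ q_ne_zero, ← zpow_zero q]
    congr 1; ring
  rwa [h1, diag_const, map_one, mul_one] at h

theorem adjoin_gensLj (m n d : ℕ) :
    Algebra.adjoin K (gensLj m n d) = Algebra.adjoin K (gens (leftBasis m n d)) := by
  refine le_antisymm (Algebra.adjoin_le ?_) (Algebra.adjoin_le ?_)
  · rintro O (⟨i, hi, hi0, h⟩ | rfl | rfl | ⟨i, hi, hi0, h⟩)
    · obtain ⟨p, hp, hp', rfl⟩ := mem_II_even.1 ⟨hi, hi0⟩
      have h0 := torus_mem_adjoin (leftBasis m n d) hp hp'.le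
      have h1 := torus_mem_adjoin (leftBasis m n d) (by omega : 0 ≤ p + 1) (by omega)
      rcases h with rfl | rfl
      · rw [BLj_eq p]
        exact mul_mem (raise_mem_adjoin _ (by omega) hp') (diag_rowSum_mem _ h1 h0 _ _ _)
      · rw [BLjn_eq hp]
        exact mul_mem (raise_mem_adjoin _ (by omega) (by omega)) (diag_rowSum_mem _ h0 h1 _ _ _)
    · rw [dL0j_eq]; exact torus_mem_adjoin _ le_rfl (by omega) _
    · rw [dL0j_eq]; exact torus_mem_adjoin _ le_rfl (by omega) _
    · obtain ⟨r, hr, hr', rfl⟩ := mem_II_odd_pos.1 ⟨hi, hi0⟩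
      rw [dLj_eq hr.ne', dLj_eq hr.ne'] at h
      rcases h with rfl | rfl <;> exact torus_mem_adjoin _ hr.le hr' _
  · have ht {r : ℤ} (hr : 0 ≤ r) (hr' : r ≤ m) (e : ℤ) :
        torus (leftBasis m n d) r e ∈ Algebra.adjoin K (gensLj m n d) := by
      rcases hr.eq_or_lt with rfl | hr0
      · exact torus_mem _ (Algebra.subset_adjoin (Or.inr (Or.inl (dL0j_eq 1).symm)))
          (Algebra.subset_adjoin (Or.inr (Or.inr (Or.inl (dL0j_eq (-1)).symm)))) e
      · obtain ⟨h1, h2⟩ := mem_II_odd_pos.2 ⟨r, hr0, hr', rfl⟩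
        exact torus_mem _
          (Algebra.subset_adjoin (Or.inr (Or.inr (Or.inr
            ⟨_, h1, h2, Or.inl (dLj_eq hr0.ne' 1).symm⟩))))
          (Algebra.subset_adjoin (Or.inr (Or.inr (Or.inr
            ⟨_, h1, h2, Or.inr (dLj_eq hr0.ne' (-1)).symm⟩)))) e
    rintro O (⟨p, hp, hp', rfl⟩ | ⟨r, hr, hr', rfl | rfl⟩)
    · by_cases h0 : 0 ≤ p
      · obtain ⟨h1, h2⟩ := mem_II_even.2 ⟨p, h0, hp', rfl⟩
        exact mem_of_mul_diag_mem _ (ht (by omega) (by omega)) (ht h0 hp'.le) _ _ _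
          (Algebra.subset_adjoin (Or.inl ⟨_, h1, h2, Or.inl (BLj_eq p).symm⟩))
      · obtain ⟨s, rfl⟩ : ∃ s, p = -s - 1 := ⟨-p - 1, by ring⟩
        have hs : 0 ≤ s := by omega
        obtain ⟨h1, h2⟩ := mem_II_even (m := m).2 ⟨s, hs, by omega, rfl⟩
        exact mem_of_mul_diag_mem _ (ht hs (by omega)) (ht (by omega) (by omega)) _ _ _
          (Algebra.subset_adjoin (Or.inl ⟨_, h1, h2, Or.inr (BLjn_eq hs).symm⟩))
    · exact ht hr hr' _
    · exact ht hr hr' _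

theorem stmt10 (m n d : ℕ) (hm : 1 ≤ m) (hn : 1 ≤ n) :
    -- (1) every left operator commutes with every right operator
    (∀ a ∈ gensLj m n d, ∀ b ∈ gensRj m n d, Commute a b) ∧
    -- (2) the double centralizer property
    Subalgebra.centralizer K
        ((Algebra.adjoin K (gensLj m n d) : Subalgebra K (Module.End K (FM (Xij m n d)))) : Set (Module.End K (FM (Xij m n d))))
      = Algebra.adjoin K (gensRj m n d) ∧
    Subalgebra.centralizer K
        ((Algebra.adjoin K (gensRj m n d) : Subalgebra K (Module.End K (FM (Xij m n d)))) : Set (Module.End K (FM (Xij m n d))))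
      = Algebra.adjoin K (gensLj m n d) := by
  have hb := vec_rightBasis m n d
  refine ⟨fun a ha b hb' => commute_adjoin _ _ hb ?_ ?_, ?_⟩
  · rw [← adjoin_gensLj]
    exact Algebra.subset_adjoin ha
  · rw [← gensRj_eq]
    exact Algebra.subset_adjoin hb'
  · rw [gensRj_eq, adjoin_gensLj]
    exact double_centralizer _ _ hb

end
end

section
/- Fix M ≥ 1 and n ≥ 1. The operators σ_0, σ_1, …, σ_{n−1} on V^{⊗n} satisfy the defining relations of the type B_n Hecke algebra ℋ_B(n): (1) (σ_i + q)(σ_i − q^{−1}) = 0 for all 0 ≤ i ≤ n−1; (2) σ_i σ_{i+1} σ_i = σ_{i+1} σ_i σ_{i+1} for 1 ≤ i ≤ n−2; (3) σ_0 σ_1 σ_0 σ_1 = σ_1 σ_0 σ_1 σ_0; (4) σ_i σ_j = σ_j σ_i whenever |i − j| > 1. Consequently the assignment sending the i-th Hecke generator to σ_i defines a representation of ℋ_B(n) on V^{⊗n}. -/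
open scoped BigOperators Classical

set_option synthInstance.maxHeartbeats 1000000
set_option maxHeartbeats 1000000

noncomputable section

/-- Basis index of `V`: elements of `𝕀_M`. -/
def SubI (M : ℕ) : Type := {a : ℚ // a ∈ II M}

/-- `V^{⊗n}`: free `ℚ(q)`-vector space on `n`-tuples from `𝕀_M`. -/
abbrev TV (n M : ℕ) : Type := (Fin n → SubI M) →₀ K

/-- Basis vector `v_λ`. -/
def tT {n M : ℕ} (l : Fin n → SubI M) : TV n M := Finsupp.single l 1

/-- A "single-target" operator on `V`: `v_a ↦ c a • v_{t a}`. -/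
structure SOp where
  t : ℚ → ℚ
  c : ℚ → K

def SOp.id' : SOp := ⟨fun a => a, fun _ => 1⟩
/-- Composite `O ∘ P`. -/
def SOp.comp (O P : SOp) : SOp := ⟨fun a => O.t (P.t a), fun a => P.c a * O.c (P.t a)⟩
/-- `E_i v_a = δ(a = i+1/2) v_{a-1}`. -/
def Eop (i : ℚ) : SOp := ⟨fun a => a - 1, fun a => if a = i + 1/2 then 1 else 0⟩
/-- `F_i v_a = δ(a = i-1/2) v_{a+1}`. -/
def Fop (i : ℚ) : SOp := ⟨fun a => a + 1, fun a => if a = i - 1/2 then 1 else 0⟩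
/-- A diagonal operator `v_a ↦ q^{f a} v_a`. -/
def diagOp (f : ℚ → ℤ) : SOp := ⟨fun a => a, fun a => q ^ f a⟩
/-- `K_i^{-1}` (diagonal). -/
def Kinv (i : ℚ) : SOp := diagOp fun a => (if a = i+1/2 then 1 else 0) - (if a = i-1/2 then 1 else 0)
/-- `K_i` (diagonal). -/
def Kpos (i : ℚ) : SOp := diagOp fun a => (if a = i-1/2 then 1 else 0) - (if a = i+1/2 then 1 else 0)
/-- `k_i^{-1} = K_i^{-1} K_{-i}`. -/
def kinv (i : ℚ) : SOp := (Kinv i).comp (Kpos (-i))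
/-- `k_i = K_i K_{-i}^{-1}`. -/
def kpos (i : ℚ) : SOp := (Kpos i).comp (Kinv (-i))
/-- `(D_r D_{-r})^e` (diagonal), `e = ±1`. -/
def DDop (r : ℚ) (e : ℤ) : SOp := diagOp fun a => e * ((if a = r then 1 else 0) + (if a = -r then 1 else 0))
/-- `D_0^e` (diagonal), `e = ±1`. -/
def D0op (e : ℤ) : SOp := diagOp fun a => e * (if a = 0 then 1 else 0)

/-- Tensor product `ops 0 ⊗ ops 1 ⊗ ⋯ ⊗ ops (n-1)` of single-target operators on `V^{⊗n}`. -/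
def tensorOp {n M : ℕ} (ops : Fin n → SOp) : TV n M →ₗ[K] TV n M :=
  Finsupp.lift (TV n M) K (Fin n → SubI M) fun l =>
    if h : ∀ r, (ops r).t (l r).1 ∈ II M then
      Finsupp.single (fun r => ⟨(ops r).t (l r).1, h r⟩) (∏ r, (ops r).c (l r).1)
    else 0

/-- `𝓑_i` on `V^{⊗n}`, for `i ≠ 0` (ı-case) resp. `i ∈ {1/2,…,m-1/2}` (ȷ-case). -/
def calB (n M : ℕ) (i : ℚ) : TV n M →ₗ[K] TV n M :=
  (∑ r : Fin n, tensorOp fun s => if s < r then SOp.id' else if s = r then Fop i else Kinv i)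
  + (∑ r : Fin n, tensorOp fun s => if s < r then kinv i else if s = r then (Eop (-i)).comp (Kinv i) else Kinv i)

/-- `𝓑_0` on `V^{⊗n}` (ı-case). -/
def calB0 (n M : ℕ) : TV n M →ₗ[K] TV n M :=
  (∑ r : Fin n, tensorOp fun s => if s < r then SOp.id' else if s = r then Fop 0 else Kinv 0)
  + q⁻¹ • (∑ r : Fin n, tensorOp fun s => if s < r then SOp.id' else if s = r then (Eop 0).comp (Kinv 0) else Kinv 0)
  + tensorOp fun _ => Kinv 0

/-- `𝓑_{-i}` on `V^{⊗n}` (ȷ-case), for `i ∈ {1/2,…,m-1/2}`. -/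
def calBn (n M : ℕ) (i : ℚ) : TV n M →ₗ[K] TV n M :=
  (∑ r : Fin n, tensorOp fun s => if s < r then SOp.id' else if s = r then Fop (-i) else Kinv (-i))
  + (∑ r : Fin n, tensorOp fun s => if s < r then kpos i else if s = r then (Kinv (-i)).comp (Eop i) else Kinv (-i))

/-- `𝓓_r^e = ((D_r D_{-r})^e)^{⊗n}`. -/
def calD (n M : ℕ) (r : ℚ) (e : ℤ) : TV n M →ₗ[K] TV n M := tensorOp fun _ => DDop r e

/-- `𝓓_0^e = (D_0^e)^{⊗n}`. -/
def calD0 (n M : ℕ) (e : ℤ) : TV n M →ₗ[K] TV n M := tensorOp fun _ => D0op e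

/-- Negation on `𝕀_M`. -/
def negS {M : ℕ} (a : SubI M) : SubI M := ⟨-a.1, II_neg a.2⟩

/-- `λ · s` where `s` interchanges the tensor positions `a` and `b`. -/
def swapL {n M : ℕ} (a b : Fin n) (l : Fin n → SubI M) : Fin n → SubI M := l ∘ Equiv.swap a b

/-- The Hecke operator `σ` acting in tensor positions `a, b` (for `a < b` adjacent). -/
def sigmaI {n M : ℕ} (a b : Fin n) : TV n M →ₗ[K] TV n M :=
  Finsupp.lift (TV n M) K (Fin n → SubI M) fun l =>
    if (l a).1 < (l b).1 then tT (swapL a b l)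
    else if (l a).1 = (l b).1 then q⁻¹ • tT l
    else tT (swapL a b l) + (q⁻¹ - q) • tT l

/-- The Hecke operator `σ_0`. -/
def sigma0 {n M : ℕ} (hn : 0 < n) : TV n M →ₗ[K] TV n M :=
  Finsupp.lift (TV n M) K (Fin n → SubI M) fun l =>
    if 0 < (l ⟨0, hn⟩).1 then tT (Function.update l ⟨0, hn⟩ (negS (l ⟨0, hn⟩)))
    else if (l ⟨0, hn⟩).1 = 0 then q⁻¹ • tT l
    else tT (Function.update l ⟨0, hn⟩ (negS (l ⟨0, hn⟩))) + (q⁻¹ - q) • tT l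

/-- `σ_i`, `0 ≤ i ≤ n-1` (for `i ≥ 1` it acts on the 1-based entries `λ_i, λ_{i+1}`). -/
def sigmaB {n M : ℕ} (hn : 0 < n) (i : ℕ) (hi : i < n) : TV n M →ₗ[K] TV n M :=
  if i = 0 then sigma0 hn else sigmaI ⟨i - 1, by omega⟩ ⟨i, hi⟩

/-- Generator `τ_i` in the free algebra on `Fin n`. -/
def hg {n : ℕ} (i : Fin n) : FreeAlgebra K (Fin n) := FreeAlgebra.ι K i

/-- The defining relations of the type `B_n` Hecke algebra `ℋ_B(n)`
(with quadratic relation `(τ_i + q)(τ_i - q⁻¹) = 0`). -/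
inductive HRel (n : ℕ) : FreeAlgebra K (Fin n) → FreeAlgebra K (Fin n) → Prop
  | braid (i j : Fin n) (h1 : 1 ≤ (i : ℕ)) (h2 : (j : ℕ) = (i : ℕ) + 1) :
      HRel n (hg i * hg j * hg i) (hg j * hg i * hg j)
  | braid0 (i j : Fin n) (h0 : (i : ℕ) = 0) (h1 : (j : ℕ) = 1) :
      HRel n (hg i * hg j * hg i * hg j) (hg j * hg i * hg j * hg i)
  | comm (i j : Fin n) (h : (i : ℕ) + 1 < (j : ℕ) ∨ (j : ℕ) + 1 < (i : ℕ)) :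
      HRel n (hg i * hg j) (hg j * hg i)
  | quad (i : Fin n) :
      HRel n (hg i * hg i) (1 - (q - q⁻¹) • hg i)

/-- The type `B_n` Hecke algebra `ℋ_B(n)` over `ℚ(q)`, presented by generators and relations. -/
abbrev HeckeB (n : ℕ) : Type := RingQuot (HRel n)

/-- The generator `τ_i` of `ℋ_B(n)`. -/
def hτ {n : ℕ} (i : Fin n) : HeckeB n := RingQuot.mkAlgHom K (HRel n) (hg i)

/-- The diagonal coefficient of a Hecke generator with parameter `t` on a basis vector on which the
corresponding simple root takes the value `d`. -/
def heckeCoeff {F : Type*} [Field F] (t : F) (d : ℚ) : F :=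
  if 0 < d then 0 else if d = 0 then t⁻¹ - 1 else t⁻¹ - t

section heckeCoeff

variable {F : Type*} [Field F] (t : F)

theorem heckeCoeff_of_pos {d : ℚ} (h : 0 < d) : heckeCoeff t d = 0 := by
  simp [heckeCoeff, h]

theorem heckeCoeff_zero : heckeCoeff t 0 = t⁻¹ - 1 := by
  simp [heckeCoeff]

theorem heckeCoeff_of_neg {d : ℚ} (h : d < 0) : heckeCoeff t d = t⁻¹ - t := by
  simp [heckeCoeff, h.not_gt, h.ne]

end heckeCoeff

/-- The operator `v_l ↦ v_{S l} + heckeCoeff t (d l) • v_l` attached to a reflection `S` with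
root function `d`. -/
def reflOp {F X : Type*} [Field F] (t : F) (S : X → X) (d : X → ℚ) : Module.End F (X →₀ F) :=
  Finsupp.lift (X →₀ F) F X fun l =>
    Finsupp.single (S l) 1 + heckeCoeff t (d l) • Finsupp.single l 1

section reflOp

variable {F X : Type*} [Field F] {t : F} {S T : X → X} {d e : X → ℚ}

theorem reflOp_single (t : F) (S : X → X) (d : X → ℚ) (l : X) :
    reflOp t S d (Finsupp.single l 1) =
      Finsupp.single (S l) 1 + heckeCoeff t (d l) • Finsupp.single l 1 := by
  simp only [reflOp, Finsupp.lift_apply, zero_smul, Finsupp.sum_single_index, one_smul]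

theorem end_ext {f g : Module.End F (X →₀ F)}
    (h : ∀ l, f (Finsupp.single l 1) = g (Finsupp.single l 1)) : f = g :=
  Finsupp.lhom_ext' fun l => LinearMap.ext_ring (h l)

theorem reflOp_quadratic (ht : t ≠ 0) (hS : ∀ l, S (S l) = l) (hd : ∀ l, d (S l) = -d l)
    (hd0 : ∀ l, d l = 0 → S l = l) :
    (reflOp t S d + t • 1) * (reflOp t S d - t⁻¹ • 1) = 0 := by
  refine end_ext fun l => ?_
  simp only [Module.End.mul_apply, LinearMap.add_apply, LinearMap.sub_apply, LinearMap.smul_apply,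
    Module.End.one_apply, map_add, map_sub, map_smul, reflOp_single, hS, hd, LinearMap.zero_apply]
  rcases lt_trichotomy (d l) 0 with h | h | h
  · rw [heckeCoeff_of_neg t h, heckeCoeff_of_pos t (neg_pos.2 h)]
    match_scalars <;> field_simp <;> ring
  · rw [hd0 l h, h, neg_zero, heckeCoeff_zero]
    match_scalars
    field_simp
    ring
  · rw [heckeCoeff_of_pos t h, heckeCoeff_of_neg t (neg_lt_zero.2 h)]
    match_scalars <;> field_simp <;> ring

theorem reflOp_mul_self (ht : t ≠ 0) (hS : ∀ l, S (S l) = l) (hd : ∀ l, d (S l) = -d l)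
    (hd0 : ∀ l, d l = 0 → S l = l) :
    reflOp t S d * reflOp t S d = 1 - (t - t⁻¹) • reflOp t S d := by
  refine end_ext fun l => ?_
  have h := LinearMap.congr_fun (reflOp_quadratic ht hS hd hd0) (Finsupp.single l 1)
  simp only [Module.End.mul_apply, LinearMap.add_apply, LinearMap.sub_apply, LinearMap.smul_apply,
    Module.End.one_apply, map_sub, map_smul, LinearMap.zero_apply] at h ⊢
  linear_combination (norm := (match_scalars <;> field_simp <;> ring)) h

theorem reflOp_commute (hST : ∀ l, S (T l) = T (S l)) (hd : ∀ l, d (T l) = d l)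
    (he : ∀ l, e (S l) = e l) : Commute (reflOp t S d) (reflOp t T e) := by
  refine end_ext fun l => ?_
  simp only [Module.End.mul_apply, map_add, map_smul, reflOp_single, hST, hd, he]
  module

theorem reflOp_braid_three (ht : t ≠ 0) (hS : ∀ l, S (S l) = l) (hT : ∀ l, T (T l) = l)
    (hST : ∀ l, S (T (S l)) = T (S (T l)))
    (hdS : ∀ l, d (S l) = -d l) (heS : ∀ l, e (S l) = d l + e l)
    (heT : ∀ l, e (T l) = -e l) (hdT : ∀ l, d (T l) = d l + e l)
    (hd0 : ∀ l, d l = 0 → S l = l) (he0 : ∀ l, e l = 0 → T l = l) :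
    reflOp t S d * reflOp t T e * reflOp t S d = reflOp t T e * reflOp t S d * reflOp t T e := by
  refine end_ext fun l => ?_
  have h1 : d (T (S l)) = e l := by rw [hdT, hdS, heS]; ring
  have h2 : e (S (T l)) = d l := by rw [heS, heT, hdT]; ring
  simp only [Module.End.mul_apply, map_add, map_smul, reflOp_single, hST, hS, hT, h1, h2,
    hdS, heS, heT, hdT]
  generalize hf : d l + e l = f
  rcases lt_trichotomy (d l) 0 with hd | hd | hd <;>
  rcases lt_trichotomy (e l) 0 with he | he | he <;>
  rcases lt_trichotomy f 0 with hde | hde | hde <;>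
  first
  | (exfalso; linarith)
  | (try rw [hd0 l hd]
     try rw [he0 l he]
     simp only [hd, he, hde, neg_zero, heckeCoeff_zero, heckeCoeff_of_pos, heckeCoeff_of_neg,
       Left.neg_pos_iff, Left.neg_neg_iff]
     match_scalars <;> field_simp <;> ring)

theorem reflOp_braid_four (ht : t ≠ 0) (hS : ∀ l, S (S l) = l) (hT : ∀ l, T (T l) = l)
    (hST : ∀ l, S (T (S (T l))) = T (S (T (S l))))
    (hdS : ∀ l, d (S l) = -d l) (heS : ∀ l, e (S l) = 2 * d l + e l)
    (heT : ∀ l, e (T l) = -e l) (hdT : ∀ l, d (T l) = d l + e l)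
    (hd0 : ∀ l, d l = 0 → S l = l) (he0 : ∀ l, e l = 0 → T l = l) :
    reflOp t S d * reflOp t T e * reflOp t S d * reflOp t T e =
      reflOp t T e * reflOp t S d * reflOp t T e * reflOp t S d := by
  refine end_ext fun l => ?_
  have h1 : d (T (S l)) = d l + e l := by rw [hdT, hdS, heS]; ring
  have h2 : e (S (T l)) = 2 * d l + e l := by rw [heS, heT, hdT]; ring
  have h3 : d (T (S (T l))) = d l := by rw [hdT, hdS, h2, hdT]; ring
  have h4 : e (S (T (S l))) = e l := by rw [heS, heT, h1, heS]; ring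
  simp only [Module.End.mul_apply, map_add, map_smul, reflOp_single, hST, hS, hT, h1, h2, h3, h4,
    hdS, heS, heT, hdT]
  have w1 : d l + e l = 0 → S (T l) = T l := fun h => hd0 _ (by rw [hdT, h])
  have w2 : 2 * d l + e l = 0 → T (S l) = S l := fun h => he0 _ (by rw [heS, h])
  generalize hf : d l + e l = f at w1 ⊢
  generalize hg : 2 * d l + e l = g at w2 ⊢
  rcases lt_trichotomy (d l) 0 with hd | hd | hd <;>
  rcases lt_trichotomy (e l) 0 with he | he | he <;>
  rcases lt_trichotomy f 0 with hde | hde | hde <;>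
  rcases lt_trichotomy g 0 with hdde | hdde | hdde <;>
  first
  | (exfalso; linarith)
  | (try rw [hd0 l hd]
     try rw [he0 l he]
     try rw [hd0 l hd]
     try rw [w1 hde]
     try rw [w2 hdde]
     simp only [hd, he, hde, hdde, neg_zero, heckeCoeff_zero, heckeCoeff_of_pos, heckeCoeff_of_neg,
       Left.neg_pos_iff, Left.neg_neg_iff]
     match_scalars <;> field_simp <;> ring)

theorem smul_single_eq_add (c : F) (l : X) :
    c • Finsupp.single l (1 : F) = Finsupp.single l 1 + (c - 1) • Finsupp.single l 1 := by
  module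

end reflOp

section sigma

variable {n M : ℕ}

theorem swapL_left (a b : Fin n) (l : Fin n → SubI M) : swapL a b l a = l b := by
  simp [swapL]

theorem swapL_right (a b : Fin n) (l : Fin n → SubI M) : swapL a b l b = l a := by
  simp [swapL]

theorem swapL_of_ne {a b c : Fin n} (l : Fin n → SubI M) (ha : c ≠ a) (hb : c ≠ b) :
    swapL a b l c = l c := by
  simp [swapL, Equiv.swap_apply_of_ne_of_ne ha hb]

theorem swapL_swapL (a b : Fin n) (l : Fin n → SubI M) : swapL a b (swapL a b l) = l := by
  funext k; simp [swapL]

theorem swapL_eq_self {a b : Fin n} {l : Fin n → SubI M} (h : (l b).1 - (l a).1 = 0) :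
    swapL a b l = l := by
  have hab : l b = l a := Subtype.ext (sub_eq_zero.1 h)
  funext k
  simp only [swapL, Function.comp_apply, Equiv.swap_apply_def]
  split_ifs with h1 h2 <;> simp [*]

/-- Negation of the entry of `l` in position `a`. -/
def negAt (a : Fin n) (l : Fin n → SubI M) : Fin n → SubI M := Function.update l a (negS (l a))

theorem negAt_self (a : Fin n) (l : Fin n → SubI M) : negAt a l a = negS (l a) := by
  simp [negAt]

theorem negAt_of_ne {a b : Fin n} (l : Fin n → SubI M) (h : b ≠ a) : negAt a l b = l b := by
  simp [negAt, h]

theorem negS_negS (a : SubI M) : negS (negS a) = a := Subtype.ext (neg_neg a.1)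

theorem negAt_negAt (a : Fin n) (l : Fin n → SubI M) : negAt a (negAt a l) = l := by
  simp [negAt, negS_negS]

theorem negAt_eq_self {a : Fin n} {l : Fin n → SubI M} (h : (l a).1 = 0) : negAt a l = l := by
  have : negS (l a) = l a := Subtype.ext (by simp [negS, h])
  simp [negAt, this]

theorem sigmaI_eq_reflOp (a b : Fin n) :
    (sigmaI a b : Module.End K (TV n M)) =
      reflOp q (swapL a b) fun l => (l b).1 - (l a).1 := by
  refine end_ext fun l => ?_
  rw [reflOp_single]
  simp only [sigmaI, Finsupp.lift_apply, zero_smul, Finsupp.sum_single_index, one_smul, tT]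
  rcases lt_trichotomy (l a).1 (l b).1 with h | h | h
  · rw [if_pos h, heckeCoeff_of_pos q (sub_pos.2 h), zero_smul, add_zero]
  · rw [if_neg h.not_lt, if_pos h, sub_eq_zero.2 h.symm, heckeCoeff_zero,
      swapL_eq_self (sub_eq_zero.2 h.symm)]
    exact smul_single_eq_add q⁻¹ l
  · rw [if_neg h.not_gt, if_neg h.ne', heckeCoeff_of_neg q (sub_neg.2 h)]

theorem sigma0_eq_reflOp (hn : 0 < n) :
    (sigma0 hn : Module.End K (TV n M)) = reflOp q (negAt ⟨0, hn⟩) fun l => (l ⟨0, hn⟩).1 := by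
  refine end_ext fun l => ?_
  rw [reflOp_single]
  simp only [sigma0, Finsupp.lift_apply, zero_smul, Finsupp.sum_single_index, one_smul, tT]
  rcases lt_trichotomy 0 (l ⟨0, hn⟩).1 with h | h | h
  · rw [if_pos h, heckeCoeff_of_pos q h, zero_smul, add_zero, negAt]
  · rw [if_neg h.not_lt, if_pos h.symm, negAt_eq_self h.symm, ← h, heckeCoeff_zero]
    exact smul_single_eq_add q⁻¹ l
  · rw [if_neg h.not_gt, if_neg h.ne, heckeCoeff_of_neg q h, negAt]

theorem sigmaB_zero (hn : 0 < n) (h : 0 < n) :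
    (sigmaB hn 0 h : Module.End K (TV n M)) = reflOp q (negAt ⟨0, hn⟩) fun l => (l ⟨0, hn⟩).1 := by
  rw [← sigma0_eq_reflOp]; rfl

theorem sigmaB_succ (hn : 0 < n) (i : ℕ) (hi : i + 1 < n) :
    (sigmaB hn (i + 1) hi : Module.End K (TV n M)) =
      reflOp q (swapL ⟨i, Nat.lt_of_succ_lt hi⟩ ⟨i + 1, hi⟩)
        fun l => (l ⟨i + 1, hi⟩).1 - (l ⟨i, Nat.lt_of_succ_lt hi⟩).1 := by
  rw [← sigmaI_eq_reflOp]; rfl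

theorem swapL_comm {a b c d : Fin n} (hac : a ≠ c) (had : a ≠ d) (hbc : b ≠ c) (hbd : b ≠ d)
    (l : Fin n → SubI M) : swapL a b (swapL c d l) = swapL c d (swapL a b l) := by
  funext k
  simp only [swapL, Function.comp_apply, Equiv.swap_apply_def]
  grind

theorem swapL_braid {a b c : Fin n} (hab : a ≠ b) (hac : a ≠ c) (hbc : b ≠ c)
    (l : Fin n → SubI M) :
    swapL a b (swapL b c (swapL a b l)) = swapL b c (swapL a b (swapL b c l)) := by
  funext k
  simp only [swapL, Function.comp_apply, Equiv.swap_apply_def]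
  grind

theorem negAt_swapL_comm {a b c : Fin n} (hab : a ≠ b) (hac : a ≠ c) (l : Fin n → SubI M) :
    negAt a (swapL b c l) = swapL b c (negAt a l) := by
  funext k
  simp only [swapL, negAt, Function.comp_apply, Equiv.swap_apply_def, Function.update_apply]
  grind

theorem negAt_swapL_braid {a b : Fin n} (hab : a ≠ b) (l : Fin n → SubI M) :
    negAt a (swapL a b (negAt a (swapL a b l))) = swapL a b (negAt a (swapL a b (negAt a l))) := by
  funext k
  simp only [swapL, negAt, Function.comp_apply, Equiv.swap_apply_def, Function.update_apply]
  grind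

theorem sigmaB_quadratic (hn : 0 < n) (i : ℕ) (hi : i < n) :
    ((sigmaB hn i hi : Module.End K (TV n M)) + q • 1) *
      ((sigmaB hn i hi : Module.End K (TV n M)) - q⁻¹ • 1) = 0 := by
  cases i with
  | zero =>
    rw [sigmaB_zero]
    exact reflOp_quadratic q_ne_zero (negAt_negAt _) (fun l => by rw [negAt_self]; rfl)
      fun l h => negAt_eq_self h
  | succ i =>
    rw [sigmaB_succ]
    exact reflOp_quadratic q_ne_zero (swapL_swapL _ _) (fun l => by rw [swapL_left, swapL_right]; ring)
      fun l h => swapL_eq_self h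

theorem sigmaB_braid (hn : 0 < n) (i : ℕ) (h1 : 1 ≤ i) (hi : i < n) (hi1 : i + 1 < n) :
    (sigmaB hn i hi * sigmaB hn (i + 1) hi1 * sigmaB hn i hi : Module.End K (TV n M)) =
      sigmaB hn (i + 1) hi1 * sigmaB hn i hi * sigmaB hn (i + 1) hi1 := by
  obtain ⟨i, rfl⟩ := Nat.exists_eq_add_of_le' h1
  have hab : (⟨i, Nat.lt_of_succ_lt hi⟩ : Fin n) ≠ ⟨i + 1, hi⟩ := by simp
  have hac : (⟨i, Nat.lt_of_succ_lt hi⟩ : Fin n) ≠ ⟨i + 1 + 1, hi1⟩ := by simp; omega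
  have hbc : (⟨i + 1, hi⟩ : Fin n) ≠ ⟨i + 1 + 1, hi1⟩ := by simp
  rw [sigmaB_succ, sigmaB_succ]
  refine reflOp_braid_three q_ne_zero (swapL_swapL _ _) (swapL_swapL _ _) (swapL_braid hab hac hbc)
    ?_ ?_ ?_ ?_ (fun l h => swapL_eq_self h) (fun l h => swapL_eq_self h)
  all_goals
    intro l
    simp only [swapL_left, swapL_right, swapL_of_ne l hac.symm hbc.symm, swapL_of_ne l hab hac]
    ring

theorem sigmaB_braid_zero (hn : 0 < n) (h1 : 1 < n) :
    (sigmaB hn 0 hn * sigmaB hn 1 h1 * sigmaB hn 0 hn * sigmaB hn 1 h1 :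
        Module.End K (TV n M)) =
      sigmaB hn 1 h1 * sigmaB hn 0 hn * sigmaB hn 1 h1 * sigmaB hn 0 hn := by
  have hab : (⟨0, hn⟩ : Fin n) ≠ ⟨0 + 1, h1⟩ := by simp
  rw [sigmaB_zero, sigmaB_succ hn 0 h1]
  refine reflOp_braid_four q_ne_zero (negAt_negAt _) (swapL_swapL _ _) (negAt_swapL_braid hab)
    (fun l => ?_) (fun l => ?_) (fun l => ?_) (fun l => ?_)
    (fun l h => negAt_eq_self h) (fun l h => swapL_eq_self h)
  · rw [negAt_self]; rfl
  · rw [negAt_self, negAt_of_ne l hab.symm]; simp only [negS]; ring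
  · rw [swapL_left, swapL_right]; ring
  · rw [swapL_left]; ring

theorem sigmaB_commute_of_lt (hn : 0 < n) (i j : ℕ) (hi : i < n) (hj : j < n) (h : i + 1 < j) :
    Commute (sigmaB hn i hi : Module.End K (TV n M)) (sigmaB hn j hj) := by
  obtain ⟨j, rfl⟩ := Nat.exists_eq_add_of_le' (show 1 ≤ j by omega)
  rw [sigmaB_succ hn j hj]
  cases i with
  | zero =>
    have h1 : (⟨0, hn⟩ : Fin n) ≠ ⟨j, Nat.lt_of_succ_lt hj⟩ := by simp; omega
    have h2 : (⟨0, hn⟩ : Fin n) ≠ ⟨j + 1, hj⟩ := by simp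
    rw [sigmaB_zero]
    exact reflOp_commute (negAt_swapL_comm h1 h2) (fun l => by rw [swapL_of_ne l h1 h2])
      fun l => by rw [negAt_of_ne l h1.symm, negAt_of_ne l h2.symm]
  | succ i =>
    have h1 : (⟨i, Nat.lt_of_succ_lt hi⟩ : Fin n) ≠ ⟨j, Nat.lt_of_succ_lt hj⟩ := by simp; omega
    have h2 : (⟨i, Nat.lt_of_succ_lt hi⟩ : Fin n) ≠ ⟨j + 1, hj⟩ := by simp; omega
    have h3 : (⟨i + 1, hi⟩ : Fin n) ≠ ⟨j, Nat.lt_of_succ_lt hj⟩ := by simp; omega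
    have h4 : (⟨i + 1, hi⟩ : Fin n) ≠ ⟨j + 1, hj⟩ := by simp; omega
    rw [sigmaB_succ hn i hi]
    exact reflOp_commute (swapL_comm h1 h2 h3 h4)
      (fun l => by rw [swapL_of_ne l h1 h2, swapL_of_ne l h3 h4])
      fun l => by rw [swapL_of_ne l h1.symm h3.symm, swapL_of_ne l h2.symm h4.symm]

theorem sigmaB_commute (hn : 0 < n) (i j : ℕ) (hi : i < n) (hj : j < n)
    (h : i + 1 < j ∨ j + 1 < i) :
    Commute (sigmaB hn i hi : Module.End K (TV n M)) (sigmaB hn j hj) :=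
  h.elim (sigmaB_commute_of_lt hn i j hi hj) fun h => (sigmaB_commute_of_lt hn j i hj hi h).symm

theorem sigmaB_mul_self (hn : 0 < n) (i : ℕ) (hi : i < n) :
    (sigmaB hn i hi * sigmaB hn i hi : Module.End K (TV n M)) =
      1 - (q - q⁻¹) • (sigmaB hn i hi : Module.End K (TV n M)) := by
  cases i with
  | zero =>
    rw [sigmaB_zero]
    exact reflOp_mul_self q_ne_zero (negAt_negAt _) (fun l => by rw [negAt_self]; rfl)
      fun l h => negAt_eq_self h
  | succ i =>
    rw [sigmaB_succ]
    exact reflOp_mul_self q_ne_zero (swapL_swapL _ _)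
      (fun l => by rw [swapL_left, swapL_right]; ring) fun l h => swapL_eq_self h

/-- The representation of `ℋ_B(n)` on `V^{⊗n}` with `τ_i ↦ σ_i`. -/
def heckeRep (M : ℕ) (hn : 0 < n) : HeckeB n →ₐ[K] Module.End K (TV n M) :=
  RingQuot.liftAlgHom K ⟨FreeAlgebra.lift K fun i : Fin n => sigmaB hn i i.2, by
    intro x y h
    cases h with
    | braid i j h1 h2 =>
      obtain ⟨j, hj⟩ := j
      obtain rfl : j = i + 1 := h2
      simpa [hg] using sigmaB_braid hn i h1 i.2 hj
    | braid0 i j h0 h1 =>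
      obtain ⟨i, hi⟩ := i
      obtain ⟨j, hj⟩ := j
      obtain rfl : i = 0 := h0
      obtain rfl : j = 1 := h1
      simpa [hg] using sigmaB_braid_zero hn hj
    | comm i j h => simpa [hg] using (sigmaB_commute hn i j i.2 j.2 h).eq
    | quad i => simpa [hg] using sigmaB_mul_self hn i i.2⟩

theorem heckeRep_hτ (M : ℕ) (hn : 0 < n) (i : Fin n) :
    heckeRep M hn (hτ i) = sigmaB hn i i.2 := by
  simp [heckeRep, hτ, hg]

end sigma

theorem stmt13 (Mdim n : ℕ) (hn : 0 < n) :
    -- (1) quadratic Hecke relation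
    (∀ i : ℕ, ∀ hi : i < n,
        ((sigmaB hn i hi : Module.End K (TV n Mdim)) + q • 1)
          * ((sigmaB hn i hi : Module.End K (TV n Mdim)) - q⁻¹ • 1) = 0) ∧
    -- (2) type A braid relations
    (∀ i : ℕ, 1 ≤ i → ∀ hi1 : i + 1 < n,
        (sigmaB (M := Mdim) hn i (by omega) * sigmaB hn (i+1) hi1 * sigmaB hn i (by omega) : Module.End K (TV n Mdim))
          = sigmaB hn (i+1) hi1 * sigmaB hn i (by omega) * sigmaB hn (i+1) hi1) ∧
    -- (3) the type B braid relation σ₀σ₁σ₀σ₁ = σ₁σ₀σ₁σ₀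
    (∀ h1 : 1 < n,
        (sigmaB (M := Mdim) hn 0 (by omega) * sigmaB hn 1 h1 * sigmaB hn 0 (by omega) * sigmaB hn 1 h1 : Module.End K (TV n Mdim))
          = sigmaB hn 1 h1 * sigmaB hn 0 (by omega) * sigmaB hn 1 h1 * sigmaB hn 0 (by omega)) ∧
    -- (4) distant commutation
    (∀ i j : ℕ, ∀ hi : i < n, ∀ hj : j < n, (i + 1 < j ∨ j + 1 < i) →
        Commute (sigmaB hn i hi : Module.End K (TV n Mdim)) (sigmaB hn j hj)) ∧
    -- Consequently, τ_i ↦ σ_i defines a representation of ℋ_B(n) on V^{⊗n}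
    (∃ φ : HeckeB n →ₐ[K] Module.End K (TV n Mdim),
        ∀ (i : ℕ) (hi : i < n), φ (hτ ⟨i, hi⟩) = sigmaB hn i hi) := by
  exact ⟨sigmaB_quadratic hn, fun i h1 hi1 => sigmaB_braid hn i h1 (by omega) hi1,
    sigmaB_braid_zero hn, sigmaB_commute hn, heckeRep Mdim hn,
    fun i hi => heckeRep_hτ Mdim hn ⟨i, hi⟩⟩

end
end
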